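/- arXiv:2306.08090 — 9 statements merged into one kernel-verified Lean document; each statement's English description precedes it below -/
import Mathlib

section
/- Let V : [0,∞) → ℝ be continuously differentiable with V(t) ≥ 0 for all t ≥ 0. Suppose there exist λ > 0 and α ∈ (0,1) such that V'(t) ≤ −λ·V(t)^α at every t ≥ 0 with V(t) > 0. Then V(t) = 0 for all t ≥ T₀, where T₀ := V(0)^{1−α}/(λ(1−α)). -/
open Set in
/-- A nonnegative differentiable function on `[0, ∞)` whose derivative is nonpositive wherever
it is positive is antitone: at its interior zeros the derivative vanishes. -/
theorem antitoneOn_Ici_of_deriv_nonpos_of_pos {V : ℝ → ℝ} (hV : Differentiable ℝ V)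
    (hnn : ∀ t : ℝ, 0 ≤ t → 0 ≤ V t) (hderiv : ∀ t : ℝ, 0 ≤ t → 0 < V t → deriv V t ≤ 0) :
    AntitoneOn V (Ici 0) := by
  refine antitoneOn_of_deriv_nonpos (convex_Ici 0) hV.continuous.continuousOn
    hV.differentiableOn fun x hx => ?_
  rw [interior_Ici] at hx
  have hx0 : 0 < x := hx
  rcases (hnn x hx0.le).eq_or_lt with h | h
  · have hmin : IsLocalMin V x := by
      filter_upwards [Ioi_mem_nhds hx0] with y hy
      rw [← h]
      exact hnn y (le_of_lt hy)
    exact hmin.deriv_eq_zero.le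
  · exact hderiv x hx0.le h

open Set in
/-- Integrated form of `V' ≤ -lam * V ^ α` on an interval where `V` is positive. -/
theorem rpow_one_sub_add_le_of_deriv_le {V : ℝ → ℝ} (hV : Differentiable ℝ V) {lam α t : ℝ}
    (hα : α < 1) (ht : 0 ≤ t) (hpos : ∀ s ∈ Icc 0 t, 0 < V s)
    (hineq : ∀ s ∈ Icc 0 t, deriv V s ≤ -lam * V s ^ α) :
    V t ^ (1 - α) + lam * (1 - α) * t ≤ V 0 ^ (1 - α) := by
  have hW : ∀ s ∈ Icc 0 t, HasDerivAt (fun s => V s ^ (1 - α) + lam * (1 - α) * s)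
      (deriv V s * (1 - α) * V s ^ (1 - α - 1) + lam * (1 - α)) s := by
    intro s hs
    have h := ((hV s).hasDerivAt.rpow_const (p := 1 - α) (Or.inl (hpos s hs).ne')).fun_add
      ((hasDerivAt_id' s).const_mul (lam * (1 - α)))
    rwa [mul_one] at h
  have hanti : AntitoneOn (fun s => V s ^ (1 - α) + lam * (1 - α) * s) (Icc 0 t) := by
    refine antitoneOn_of_deriv_nonpos (convex_Icc 0 t)
      (fun s hs => (hW s hs).continuousAt.continuousWithinAt)
      (fun s hs => (hW s (interior_subset hs)).differentiableAt.differentiableWithinAt)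
      fun s hs => ?_
    have hs' := interior_subset hs
    rw [(hW s hs').deriv]
    have hcancel : V s ^ α * V s ^ (1 - α - 1) = 1 := by
      rw [← Real.rpow_add (hpos s hs')]
      simp
    have hbound := mul_le_mul_of_nonneg_right (hineq s hs')
      (mul_nonneg (sub_nonneg.2 hα.le) (Real.rpow_nonneg (hpos s hs').le (1 - α - 1)))
    linear_combination hbound - lam * (1 - α) * hcancel
  simpa using hanti (left_mem_Icc.2 ht) (right_mem_Icc.2 ht) ht

/-- scalar Lyapunov comparison form of finite-time stability (FTS):
a nonnegative continuously differentiable function satisfying `V' ≤ -λ V^α`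
(whenever `V > 0`) with `λ > 0`, `α ∈ (0,1)` reaches zero by the settling time
`T₀ = V(0)^(1-α) / (λ (1-α))` and stays at zero. -/
theorem fts_lyapunov (V : ℝ → ℝ) (hV : ContDiff ℝ 1 V)
    (hnn : ∀ t : ℝ, 0 ≤ t → 0 ≤ V t)
    (lam α : ℝ) (hlam : 0 < lam) (hα : α ∈ Set.Ioo (0 : ℝ) 1)
    (hineq : ∀ t : ℝ, 0 ≤ t → 0 < V t → deriv V t ≤ -lam * V t ^ α) :
    ∀ t : ℝ, V 0 ^ (1 - α) / (lam * (1 - α)) ≤ t → V t = 0 := by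
  intro t ht
  have hV' : Differentiable ℝ V := hV.differentiable one_ne_zero
  have hc : 0 < lam * (1 - α) := mul_pos hlam (sub_pos.2 hα.2)
  have ht0 : 0 ≤ t := (div_nonneg (Real.rpow_nonneg (hnn 0 le_rfl) _) hc.le).trans ht
  by_contra hne
  have hpos : 0 < V t := (hnn t ht0).lt_of_ne' hne
  have hanti := antitoneOn_Ici_of_deriv_nonpos_of_pos hV' hnn fun s hs hs' =>
    (hineq s hs hs').trans <| by
      rw [neg_mul]
      exact neg_nonpos.2 (mul_nonneg hlam.le (Real.rpow_nonneg hs'.le _))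
  have hposOn : ∀ s ∈ Set.Icc 0 t, 0 < V s := fun s hs => hpos.trans_le (hanti hs.1 ht0 hs.2)
  have hle := rpow_one_sub_add_le_of_deriv_le hV' hα.2 ht0 hposOn
    fun s hs => hineq s hs.1 (hposOn s hs)
  rw [div_le_iff₀ hc] at ht
  have := Real.rpow_pos_of_pos hpos (1 - α)
  linarith
end

section
/- Let V : [0,∞) → ℝ be continuously differentiable with V(t) ≥ 0 for all t ≥ 0, and suppose there exist λ₁, λ₂, η > 0 and α ∈ (0,1) such that V'(t) ≤ −λ₁·V(t) − λ₂·V(t)^α + η for all t ≥ 0. Then for every θ₀ ∈ (0,1), V(t) ≤ min{ η/((1−θ₀)λ₁), (η/((1−θ₀)λ₂))^{1/α} } for all t ≥ T, where T := max{ (1/(θ₀λ₁(1−α)))·ln((θ₀λ₁·V(0)^{1−α} + λ₂)/λ₂), (1/(λ₁(1−α)))·ln((λ₁·V(0)^{1−α} + θ₀λ₂)/(θ₀λ₂)) }. -/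
/-- If `V' ≤ -a V - b V^α` holds whenever `V` is at least the level `c > 0`, then `V` is at most `c`
from the settling time of the comparison equation `v' = -a v - b v^α` on. -/
theorem le_of_deriv_le_neg_mul_sub_mul_rpow {V : ℝ → ℝ} (hV : Differentiable ℝ V)
    {a b c α t : ℝ} (ha : 0 < a) (hb : 0 < b) (hc : 0 < c) (hα : α < 1) (h0 : 0 ≤ V 0)
    (hdec : ∀ s, 0 ≤ s → c ≤ V s → deriv V s ≤ -a * V s - b * V s ^ α)
    (ht : (1 / (a * (1 - α))) * Real.log ((a * V 0 ^ (1 - α) + b) / b) ≤ t) :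
    V t ≤ c := by
  have hk : 0 < a * (1 - α) := mul_pos ha (sub_pos.2 hα)
  have hW0 : 0 ≤ a * V 0 ^ (1 - α) := by positivity
  have ht0 : 0 ≤ t := by
    refine le_trans (mul_nonneg (by positivity) (Real.log_nonneg ?_)) ht
    rw [le_div_iff₀ hb]
    linarith
  by_contra! hct
  have hgt : ∀ s ∈ Set.Icc 0 t, c < V s := by
    intro s hs
    by_contra! hsc
    refine hct.not_ge (image_le_of_deriv_right_lt_deriv_boundary (f := V) (f' := deriv V)
      (B := fun _ => c) (B' := fun _ => 0) hV.continuous.continuousOn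
      (fun x _ => (hV x).hasDerivAt.hasDerivWithinAt) hsc (fun x => hasDerivAt_const x c)
      (fun x hx hxc => ?_) (Set.right_mem_Icc.2 hs.2))
    have hpos : 0 < V x := hxc ▸ hc
    have hd := hdec x (hs.1.trans hx.1) hxc.ge
    have := mul_pos ha hpos
    have := mul_pos hb (Real.rpow_pos_of_pos hpos α)
    linarith
  set g : ℝ → ℝ := fun s => (a * V s ^ (1 - α) + b) * Real.exp (a * (1 - α) * s)
  have hg : ∀ s ∈ Set.Icc 0 t, HasDerivAt g
      (a * (deriv V s * (1 - α) * V s ^ (1 - α - 1)) * Real.exp (a * (1 - α) * s) +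
        (a * V s ^ (1 - α) + b) *
          (Real.exp (a * (1 - α) * s) * (a * (1 - α)))) s := by
    intro s hs
    have h1 := (hV s).hasDerivAt.rpow_const (p := 1 - α) (Or.inl (hc.trans (hgt s hs)).ne')
    have h2 := ((hasDerivAt_id s).const_mul (a * (1 - α))).exp
    simp only [id, mul_one] at h2
    exact ((h1.const_mul a).add_const b).mul h2
  have hanti : AntitoneOn g (Set.Icc 0 t) := by
    refine antitoneOn_of_deriv_nonpos (convex_Icc 0 t)
      (fun s hs => (hg s hs).continuousAt.continuousWithinAt)
      (fun s hs => (hg s (interior_subset hs)).differentiableAt.differentiableWithinAt)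
      (fun s hs => ?_)
    have hs := interior_subset hs
    have hpos := hc.trans (hgt s hs)
    have hd := hdec s hs.1 (hgt s hs).le
    rw [(hg s hs).deriv]
    have e1 : V s ^ (1 - α) = V s * V s ^ (1 - α - 1) := by
      rw [Real.rpow_sub_one hpos.ne', mul_div_cancel₀ _ hpos.ne']
    have e2 : V s ^ α * V s ^ (1 - α - 1) = 1 := by
      rw [← Real.rpow_add hpos, show α + (1 - α - 1) = 0 by ring, Real.rpow_zero]
    have hfac : a * (deriv V s * (1 - α) * V s ^ (1 - α - 1)) * Real.exp (a * (1 - α) * s) +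
        (a * V s ^ (1 - α) + b) * (Real.exp (a * (1 - α) * s) * (a * (1 - α))) =
        a * (1 - α) * Real.exp (a * (1 - α) * s) * V s ^ (1 - α - 1) *
          (deriv V s - (-a * V s - b * V s ^ α)) := by
      rw [e1]
      linear_combination (-(a * (1 - α) * Real.exp (a * (1 - α) * s) * b)) * e2
    rw [hfac]
    exact mul_nonpos_of_nonneg_of_nonpos (by positivity) (by linarith)
  have hle : g t ≤ g 0 := hanti (Set.left_mem_Icc.2 ht0) (Set.right_mem_Icc.2 ht0) ht0
  have hexp : (a * V 0 ^ (1 - α) + b) / b ≤ Real.exp (a * (1 - α) * t) := by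
    rw [← Real.log_le_iff_le_exp (by positivity)]
    rwa [one_div, inv_mul_le_iff₀ hk] at ht
  rw [div_le_iff₀ hb] at hexp
  simp only [g, mul_zero, Real.exp_zero, mul_one] at hle
  have hWt : 0 < a * V t ^ (1 - α) := mul_pos ha (Real.rpow_pos_of_pos (hc.trans hct) _)
  have := mul_pos hWt (Real.exp_pos (a * (1 - α) * t))
  linarith

/-- scalar Lyapunov comparison form of practical finite-time stability (PFTS):
a nonnegative continuously differentiable function satisfying `V' ≤ -λ₁ V - λ₂ V^α + η`
converges in finite time to the explicit neighborhood of zero and remains there. -/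
theorem pfts_lyapunov (V : ℝ → ℝ) (hV : ContDiff ℝ 1 V)
    (hnn : ∀ t : ℝ, 0 ≤ t → 0 ≤ V t)
    (lam1 lam2 η α : ℝ) (hlam1 : 0 < lam1) (hlam2 : 0 < lam2) (hη : 0 < η)
    (hα : α ∈ Set.Ioo (0 : ℝ) 1)
    (hineq : ∀ t : ℝ, 0 ≤ t →
      deriv V t ≤ -lam1 * V t - lam2 * V t ^ α + η) :
    ∀ θ₀ ∈ Set.Ioo (0 : ℝ) 1, ∀ t : ℝ,
      max ((1 / (θ₀ * lam1 * (1 - α))) *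
            Real.log ((θ₀ * lam1 * V 0 ^ (1 - α) + lam2) / lam2))
          ((1 / (lam1 * (1 - α))) *
            Real.log ((lam1 * V 0 ^ (1 - α) + θ₀ * lam2) / (θ₀ * lam2))) ≤ t →
      V t ≤ min (η / ((1 - θ₀) * lam1)) ((η / ((1 - θ₀) * lam2)) ^ (1 / α)) := by
  intro θ₀ hθ t ht
  obtain ⟨hα0, hα1⟩ := hα
  obtain ⟨hθ0, hθ1⟩ := hθ
  have hθ' : 0 < 1 - θ₀ := sub_pos.2 hθ1
  have hd : Differentiable ℝ V := hV.differentiable one_ne_zero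
  have hV0 := hnn 0 le_rfl
  refine le_min ?_ ?_
  · refine le_of_deriv_le_neg_mul_sub_mul_rpow hd (mul_pos hθ0 hlam1) hlam2 (by positivity) hα1 hV0
      (fun s hs hcs => ?_) ((le_max_left _ _).trans ht)
    rw [div_le_iff₀ (by positivity)] at hcs
    linarith [hineq s hs]
  · refine le_of_deriv_le_neg_mul_sub_mul_rpow hd hlam1 (mul_pos hθ0 hlam2) (by positivity) hα1 hV0
      (fun s hs hcs => ?_) ((le_max_right _ _).trans ht)
    rw [one_div, Real.rpow_inv_le_iff_of_pos (by positivity) (hnn s hs) hα0,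
      div_le_iff₀ (by positivity)] at hcs
    linarith [hineq s hs]
end

section
/- Let n ≥ 1, let μ ∈ ℝⁿ with μ ≠ 0, and let α ∈ (0,1/2). Define Y(x) := ‖x‖^{−2α}·x − ‖x+μ‖^{−2α}·(x+μ) for x ∈ ℝⁿ \ {0, −μ}, where ‖·‖ is the Euclidean norm. Then the function φ(x) := ‖Y(x)‖² attains its global maximum over ℝⁿ \ {0, −μ} at x = −μ/2; i.e., for every x ∈ ℝⁿ \ {0, −μ}, ‖Y(x)‖² ≤ ‖Y(−μ/2)‖². -/
/-- `Y(x) = ‖x‖^(-2α) x - ‖x+μ‖^(-2α) (x+μ)` on Euclidean space. -/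
noncomputable def Yfun {n : ℕ} (α : ℝ) (μ x : EuclideanSpace ℝ (Fin n)) :
    EuclideanSpace ℝ (Fin n) :=
  (‖x‖ ^ (-(2 * α))) • x - (‖x + μ‖ ^ (-(2 * α))) • (x + μ)

theorem two_mul_half_rpow_ge_add {r s p : ℝ} (hr : 0 ≤ r) (hs : 0 ≤ s) (hp : 0 ≤ p)
    (hp1 : p ≤ 1) : r ^ p + s ^ p ≤ 2 * ((r + s) / 2) ^ p := by
  have h := (Real.concaveOn_rpow hp hp1).2 (Set.mem_Ici.2 hr) (Set.mem_Ici.2 hs)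
    one_half_pos.le one_half_pos.le (add_halves 1)
  simp only [smul_eq_mul] at h
  rw [show (1 / 2 : ℝ) * r + 1 / 2 * s = (r + s) / 2 by ring] at h
  linarith

theorem two_mul_half_rpow_ge_abs_sub {r s p : ℝ} (hr : 0 ≤ r) (hs : 0 ≤ s) (hp : 0 ≤ p)
    (hp1 : p ≤ 1) : |r ^ p - s ^ p| ≤ 2 * (|r - s| / 2) ^ p := by
  wlog hsr : s ≤ r generalizing r s
  · rw [abs_sub_comm, abs_sub_comm r]
    exact this hs hr (le_of_not_ge hsr)
  have hd : 0 ≤ r - s := sub_nonneg.2 hsr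
  rw [abs_of_nonneg hd, abs_of_nonneg (sub_nonneg.2 (Real.rpow_le_rpow hs hsr hp))]
  have h₁ := Real.rpow_add_le_add_rpow hs hd hp hp1
  have hd' := div_nonneg hd zero_le_two
  have h₂ := Real.rpow_add_le_add_rpow hd' hd' hp hp1
  rw [add_sub_cancel] at h₁
  rw [add_halves] at h₂
  linarith

/-- The sharp Hölder estimate for the radial power map `z ↦ ‖z‖ ^ (p - 1) • z`. -/
theorem norm_sq_rpow_smul_sub_le {V : Type*} [NormedAddCommGroup V] [InnerProductSpace ℝ V]
    {u v : V} (hu : u ≠ 0) (hv : v ≠ 0) {p : ℝ} (hp : 0 ≤ p) (hp1 : p ≤ 1) :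
    ‖(‖u‖ ^ (p - 1)) • u - (‖v‖ ^ (p - 1)) • v‖ ^ 2 ≤ 4 * (‖u - v‖ ^ 2 / 4) ^ p := by
  have hr : 0 < ‖u‖ := norm_pos_iff.2 hu
  have hs : 0 < ‖v‖ := norm_pos_iff.2 hv
  have hc := abs_le.1 (abs_real_inner_le_norm u v)
  rw [norm_sub_sq_real, norm_sub_sq_real u v, norm_smul, norm_smul, real_inner_smul_left,
    real_inner_smul_right, Real.norm_of_nonneg (by positivity), Real.norm_of_nonneg (by positivity),
    Real.rpow_sub_one hr.ne', Real.rpow_sub_one hs.ne', div_mul_cancel₀ _ hr.ne',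
    div_mul_cancel₀ _ hs.ne']
  generalize inner ℝ u v = c at hc ⊢
  generalize ‖u‖ = r at *
  generalize ‖v‖ = s at *
  obtain ⟨k, rfl⟩ : ∃ k, c = k * (r * s) := ⟨c / (r * s), by field_simp⟩
  have hrs := mul_pos hr hs
  have hk₁ : -1 ≤ k := by
    by_contra! h
    nlinarith [hc.1]
  have hk₂ : k ≤ 1 := by
    by_contra! h
    nlinarith [hc.2]
  have sq_rpow : ∀ x : ℝ, 0 ≤ x → (x ^ 2 / 4) ^ p = ((x / 2) ^ p) ^ 2 := fun x hx ↦ by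
    rw [show x ^ 2 / 4 = (x / 2) ^ 2 by ring, Real.rpow_pow_comm (by positivity)]
  have conc := (Real.concaveOn_rpow hp hp1).2
    (Set.mem_Ici.2 (show 0 ≤ |r - s| ^ 2 / 4 by positivity))
    (Set.mem_Ici.2 (show 0 ≤ (r + s) ^ 2 / 4 by positivity))
    (show 0 ≤ (1 + k) / 2 by linarith) (show 0 ≤ (1 - k) / 2 by linarith) (by ring)
  simp only [smul_eq_mul] at conc
  rw [sq_rpow _ (abs_nonneg _), sq_rpow _ (by positivity), sq_abs,
    show (1 + k) / 2 * ((r - s) ^ 2 / 4) + (1 - k) / 2 * ((r + s) ^ 2 / 4)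
      = (r ^ 2 - 2 * (k * (r * s)) + s ^ 2) / 4 by ring] at conc
  have hadd := pow_le_pow_left₀ (by positivity) (two_mul_half_rpow_ge_add hr.le hs.le hp hp1) 2
  have hsub := pow_le_pow_left₀ (abs_nonneg _) (two_mul_half_rpow_ge_abs_sub hr.le hs.le hp hp1) 2
  rw [sq_abs] at hsub
  calc _ = (1 + k) / 2 * (r ^ p - s ^ p) ^ 2 + (1 - k) / 2 * (r ^ p + s ^ p) ^ 2 := by
        field_simp
        ring
    _ ≤ (1 + k) / 2 * (2 * (|r - s| / 2) ^ p) ^ 2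
        + (1 - k) / 2 * (2 * ((r + s) / 2) ^ p) ^ 2 :=
        add_le_add (mul_le_mul_of_nonneg_left hsub (by linarith))
          (mul_le_mul_of_nonneg_left hadd (by linarith))
    _ ≤ _ := by linarith

/-- for `μ ≠ 0` and `α ∈ (0,1/2)`, the function `φ(x) = ‖Y(x)‖²`
attains its global maximum over `ℝⁿ \ {0, -μ}` at `x = -μ/2`. -/
theorem Yfun_sq_norm_max (n : ℕ) (hn : 1 ≤ n)
    (μ : EuclideanSpace ℝ (Fin n)) (hμ : μ ≠ 0)
    (α : ℝ) (hα : α ∈ Set.Ioo (0 : ℝ) (1 / 2)) :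
    ∀ x : EuclideanSpace ℝ (Fin n), x ≠ 0 → x ≠ -μ →
      ‖Yfun α μ x‖ ^ 2 ≤ ‖Yfun α μ (-(1 / 2 : ℝ) • μ)‖ ^ 2 := by
  intro x hx hxμ
  obtain ⟨hα₀, hα₁⟩ := hα
  have hxμ' : x + μ ≠ 0 := fun h ↦ hxμ (eq_neg_of_add_eq_zero_left h)
  have hm : 0 < ‖μ‖ := norm_pos_iff.2 hμ
  have key := norm_sq_rpow_smul_sub_le hx hxμ' (p := 1 - 2 * α) (by linarith) (by linarith)
  rw [show 1 - 2 * α - 1 = -(2 * α) by ring, sub_add_cancel_left, norm_neg] at key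
  refine key.trans_eq ?_
  have hY : Yfun α μ (-(1 / 2 : ℝ) • μ) = (-(‖μ‖ / 2) ^ (-(2 * α))) • μ := by
    have hadd : -(1 / 2 : ℝ) • μ + μ = (1 / 2 : ℝ) • μ := by module
    have hnorm : ‖(1 / 2 : ℝ) • μ‖ = ‖μ‖ / 2 := by
      rw [norm_smul, Real.norm_of_nonneg (by norm_num)]
      ring
    rw [Yfun, hadd, neg_smul, norm_neg, hnorm]
    module
  rw [hY, norm_smul, norm_neg, Real.norm_of_nonneg (by positivity),
    show ‖μ‖ ^ 2 / 4 = (‖μ‖ / 2) ^ 2 by ring, ← Real.rpow_pow_comm (by positivity),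
    sub_eq_add_neg, Real.rpow_add (by positivity), Real.rpow_one]
  ring
end

section
/- Let n ≥ 1, let μ ∈ ℝⁿ with μ ≠ 0, and let α ∈ (0,1/2). Define Y(x) := ‖x‖^{−2α}·x − ‖x+μ‖^{−2α}·(x+μ) for x ∈ ℝⁿ \ {0, −μ}. Then ‖Y(−μ/2)‖ = 2^{2α}·‖μ‖^{1−2α}, and consequently ‖Y(x)‖ ≤ 2^{2α}·‖μ‖^{1−2α} for every x ∈ ℝⁿ \ {0, −μ}. -/
theorem Real.rpow_add_rpow_le_two_rpow_mul {a b s : ℝ} (ha : 0 ≤ a) (hb : 0 ≤ b) (hs0 : 0 ≤ s)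
    (hs1 : s ≤ 1) : a ^ s + b ^ s ≤ 2 ^ (1 - s) * (a + b) ^ s := by
  have h := (Real.concaveOn_rpow hs0 hs1).2 (Set.mem_Ici.2 ha) (Set.mem_Ici.2 hb)
    (by norm_num : (0 : ℝ) ≤ 1 / 2) (by norm_num : (0 : ℝ) ≤ 1 / 2) (by norm_num)
  simp only [smul_eq_mul] at h
  rw [← mul_add, ← mul_add, Real.mul_rpow (by norm_num) (by positivity), one_div,
    Real.inv_rpow (by norm_num)] at h
  rw [Real.rpow_sub (by norm_num), Real.rpow_one, div_eq_mul_inv]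
  linarith

theorem Real.abs_rpow_sub_rpow_le {a b s : ℝ} (ha : 0 ≤ a) (hb : 0 ≤ b) (hs0 : 0 ≤ s)
    (hs1 : s ≤ 1) : |a ^ s - b ^ s| ≤ |a - b| ^ s := by
  wlog hab : b ≤ a generalizing a b
  · rw [abs_sub_comm, abs_sub_comm a]
    exact this hb ha (le_of_not_ge hab)
  have h := Real.rpow_add_le_add_rpow (sub_nonneg.2 hab) hb hs0 hs1
  rw [sub_add_cancel] at h
  rw [abs_of_nonneg (sub_nonneg.2 hab),
    abs_of_nonneg (sub_nonneg.2 (Real.rpow_le_rpow hb hab hs0))]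
  linarith

/-- The map `u ↦ ‖u‖ ^ (s - 1) • u` is `s`-Hölder with constant `2 ^ (1 - s)` away from `0`. -/
theorem norm_rpow_smul_sub_rpow_smul_le {E : Type*} [NormedAddCommGroup E]
    [InnerProductSpace ℝ E] {u v : E} (hu : u ≠ 0) (hv : v ≠ 0) {s : ℝ} (hs0 : 0 ≤ s)
    (hs1 : s ≤ 1) :
    ‖‖u‖ ^ (s - 1) • u - ‖v‖ ^ (s - 1) • v‖ ≤ 2 ^ (1 - s) * ‖u - v‖ ^ s := by
  have ha : 0 < ‖u‖ := norm_pos_iff.2 hu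
  have hb : 0 < ‖v‖ := norm_pos_iff.2 hv
  obtain ⟨hc₁, hc₂⟩ := abs_le.1 (abs_real_inner_le_norm u v)
  have hD := norm_sub_sq_real u v
  have hN := norm_sub_sq_real (‖u‖ ^ (s - 1) • u) (‖v‖ ^ (s - 1) • v)
  rw [real_inner_smul_left, real_inner_smul_right, norm_smul, norm_smul,
    Real.norm_of_nonneg (by positivity), Real.norm_of_nonneg (by positivity)] at hN
  have hsum := Real.rpow_add_rpow_le_two_rpow_mul ha.le hb.le hs0 hs1
  have hdiff := Real.abs_rpow_sub_rpow_le ha.le hb.le hs0 hs1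
  have hua : ‖u‖ ^ s = ‖u‖ ^ (s - 1) * ‖u‖ := by
    rw [← Real.rpow_add_one ha.ne', sub_add_cancel]
  have hvb : ‖v‖ ^ s = ‖v‖ ^ (s - 1) * ‖v‖ := by
    rw [← Real.rpow_add_one hb.ne', sub_add_cancel]
  have hsq (x : ℝ) (hx : 0 ≤ x) : (x ^ 2) ^ s = (x ^ s) ^ 2 := by
    rw [← Real.rpow_natCast_mul hx, ← Real.rpow_mul_natCast hx, mul_comm]
  have hK : (1 : ℝ) ≤ 2 ^ (1 - s) := Real.one_le_rpow (by norm_num) (by linarith)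
  have hnorm : 0 ≤ ‖u - v‖ := norm_nonneg _
  generalize inner ℝ u v = c at *
  generalize ‖u‖ = a at *
  generalize ‖v‖ = b at *
  generalize ‖u - v‖ = d at *
  generalize (2 : ℝ) ^ (1 - s) = K at *
  obtain ⟨t, rfl⟩ : ∃ t, c = a * b * (1 - 2 * t) :=
    ⟨(1 - c / (a * b)) / 2, by field_simp; ring⟩
  have hab : 0 < a * b := mul_pos ha hb
  have ht0 : 0 ≤ t := by nlinarith
  have ht1 : 0 ≤ 1 - t := by nlinarith
  have hconc := (Real.concaveOn_rpow hs0 hs1).2 (Set.mem_Ici.2 (sq_nonneg |a - b|))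
    (Set.mem_Ici.2 (sq_nonneg (a + b))) ht1 ht0 (by ring)
  have hcomb : (1 - t) • |a - b| ^ 2 + t • (a + b) ^ 2 = d ^ 2 := by
    rw [hD, sq_abs, smul_eq_mul, smul_eq_mul]; ring
  rw [hcomb] at hconc
  simp only [smul_eq_mul] at hconc
  rw [hsq _ (abs_nonneg _), hsq _ (by positivity), hsq _ hnorm] at hconc
  have hdiff_sq : (a ^ s - b ^ s) ^ 2 ≤ K ^ 2 * (|a - b| ^ s) ^ 2 := by
    rw [← sq_abs, ← mul_pow]
    gcongr
    exact hdiff.trans (le_mul_of_one_le_left (by positivity) hK)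
  have hsum_sq : (a ^ s + b ^ s) ^ 2 ≤ K ^ 2 * ((a + b) ^ s) ^ 2 := by
    rw [← mul_pow]
    gcongr
  refine le_of_sq_le_sq ?_ (by positivity)
  calc _ = (1 - t) * (a ^ s - b ^ s) ^ 2 + t * (a ^ s + b ^ s) ^ 2 := by
        rw [hN, hua, hvb]; ring
    _ ≤ (1 - t) * (K ^ 2 * (|a - b| ^ s) ^ 2) + t * (K ^ 2 * ((a + b) ^ s) ^ 2) := by gcongr
    _ = K ^ 2 * ((1 - t) * (|a - b| ^ s) ^ 2 + t * ((a + b) ^ s) ^ 2) := by ring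
    _ ≤ K ^ 2 * (d ^ s) ^ 2 := by gcongr
    _ = _ := by ring

/-- for `μ ≠ 0` and `α ∈ (0,1/2)`, `‖Y(-μ/2)‖ = 2^(2α) ‖μ‖^(1-2α)`,
and consequently `‖Y(x)‖ ≤ 2^(2α) ‖μ‖^(1-2α)` for every `x ∈ ℝⁿ \ {0, -μ}`. -/
theorem Yfun_norm_bound (n : ℕ) (hn : 1 ≤ n)
    (μ : EuclideanSpace ℝ (Fin n)) (hμ : μ ≠ 0)
    (α : ℝ) (hα : α ∈ Set.Ioo (0 : ℝ) (1 / 2)) :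
    ‖Yfun α μ (-(1 / 2 : ℝ) • μ)‖ = 2 ^ (2 * α) * ‖μ‖ ^ (1 - 2 * α) ∧
    ∀ x : EuclideanSpace ℝ (Fin n), x ≠ 0 → x ≠ -μ →
      ‖Yfun α μ x‖ ≤ 2 ^ (2 * α) * ‖μ‖ ^ (1 - 2 * α) := by
  obtain ⟨h0, h1⟩ := hα
  have hm : 0 < ‖μ‖ := norm_pos_iff.2 hμ
  constructor
  · have hadd : -(1 / 2 : ℝ) • μ + μ = (1 / 2 : ℝ) • μ := by module
    have hY : Yfun α μ (-(1 / 2 : ℝ) • μ) = -((1 / 2 * ‖μ‖) ^ (-(2 * α)) • μ) := by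
      rw [Yfun, hadd, norm_smul, norm_smul, norm_neg, Real.norm_of_nonneg (by norm_num)]
      module
    rw [hY, norm_neg, norm_smul, Real.norm_of_nonneg (by positivity),
      Real.mul_rpow (by norm_num) hm.le, one_div, Real.inv_rpow (by norm_num),
      Real.rpow_neg (by norm_num), inv_inv, mul_assoc, ← Real.rpow_add_one hm.ne',
      neg_add_eq_sub]
  · intro x hx hxμ
    have h := norm_rpow_smul_sub_rpow_smul_le hx (fun h => hxμ (eq_neg_of_add_eq_zero_left h) :
      x + μ ≠ 0) (s := 1 - 2 * α) (by linarith) (by linarith)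
    rwa [sub_sub_cancel_left, sub_sub_cancel, sub_add_cancel_left, norm_neg] at h
end

section
/- Fix n ≥ 1, p ∈ (1,2) and k > 0. For every e ∈ ℝⁿ with e ≠ 0 and every w ∈ ℝⁿ, the quadratic form of the linear map A_e : w ↦ k·w + ‖e‖^{2(1−p)/(3p−2)}·( w − (2(p−1)/(3p−2))·(⟨e,w⟩/‖e‖²)·e ) satisfies ( k + (p/(3p−2))·‖e‖^{2(1−p)/(3p−2)} )·‖w‖² ≤ ⟨w, A_e w⟩ ≤ ( k + ‖e‖^{2(1−p)/(3p−2)} )·‖w‖². -/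
open scoped RealInnerProductSpace

/-- eigenvalue bounds on the quadratic form of the Jacobian
`A_e : w ↦ k w + ‖e‖^(2(1-p)/(3p-2)) (w - (2(p-1)/(3p-2)) (⟨e,w⟩/‖e‖²) e)`
of `φ₁ᵖᵏ(e) = k e + ‖e‖^(2(1-p)/(3p-2)) e` at `e ≠ 0`. -/
theorem jacobian_quadratic_form_bounds (n : ℕ) (hn : 1 ≤ n) (p k : ℝ)
    (hp : p ∈ Set.Ioo (1 : ℝ) 2) (hk : 0 < k)
    (e : EuclideanSpace ℝ (Fin n)) (he : e ≠ 0)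
    (w : EuclideanSpace ℝ (Fin n)) :
    (k + (p / (3 * p - 2)) * ‖e‖ ^ (2 * (1 - p) / (3 * p - 2))) * ‖w‖ ^ 2 ≤
      ⟪w, k • w + (‖e‖ ^ (2 * (1 - p) / (3 * p - 2))) •
        (w - ((2 * (p - 1) / (3 * p - 2)) * (⟪e, w⟫ / ‖e‖ ^ 2)) • e)⟫ ∧
    ⟪w, k • w + (‖e‖ ^ (2 * (1 - p) / (3 * p - 2))) •
        (w - ((2 * (p - 1) / (3 * p - 2)) * (⟪e, w⟫ / ‖e‖ ^ 2)) • e)⟫ ≤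
      (k + ‖e‖ ^ (2 * (1 - p) / (3 * p - 2))) * ‖w‖ ^ 2 := by
  obtain ⟨hp1, -⟩ := hp
  have hd : 0 < 3 * p - 2 := by linarith
  have ha : 0 ≤ 2 * (p - 1) / (3 * p - 2) := div_nonneg (by linarith) hd.le
  have hpa : p / (3 * p - 2) = 1 - 2 * (p - 1) / (3 * p - 2) := by
    rw [eq_sub_iff_add_eq, ← add_div, div_eq_one_iff_eq hd.ne']
    ring
  have hc : 0 ≤ ‖e‖ ^ (2 * (1 - p) / (3 * p - 2)) := by positivity
  rw [hpa]
  generalize ‖e‖ ^ (2 * (1 - p) / (3 * p - 2)) = c at *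
  generalize 2 * (p - 1) / (3 * p - 2) = a at *
  have hs : ⟪e, w⟫ ^ 2 / ‖e‖ ^ 2 ≤ ‖w‖ ^ 2 := by
    rw [div_le_iff₀ (pow_pos (norm_pos_iff.mpr he) 2), ← mul_pow, mul_comm]
    exact sq_le_sq.mpr ((abs_real_inner_le_norm e w).trans (le_abs_self _))
  have hs0 : 0 ≤ ⟪e, w⟫ ^ 2 / ‖e‖ ^ 2 := by positivity
  have hform : ⟪w, k • w + c • (w - (a * (⟪e, w⟫ / ‖e‖ ^ 2)) • e)⟫ =
      (k + c) * ‖w‖ ^ 2 - c * a * (⟪e, w⟫ ^ 2 / ‖e‖ ^ 2) := by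
    rw [inner_add_right, real_inner_smul_right, real_inner_smul_right, inner_sub_right,
      real_inner_smul_right, real_inner_self_eq_norm_sq, real_inner_comm e w]
    ring
  rw [hform]
  have hca : 0 ≤ c * a := mul_nonneg hc ha
  constructor
  · linarith [mul_le_mul_of_nonneg_left hs hca]
  · linarith [mul_nonneg hca hs0]
end

section
/- Fix n ≥ 1, p ∈ (1,2) and k₁, k₂, k₃ > 0. Let Q* be a symmetric positive definite 2×2 real matrix and let P* = [[p₁₁, p₁₂],[p₁₂, p₂₂]] be a symmetric positive definite solution of (A*)ᵀP* + P*A* = −Q*, where A* = [[−k₁, 1],[−k₂, 0]]. Let p_m, p_M, q_m > 0 satisfy p_m‖z‖² ≤ zᵀP*z ≤ p_M‖z‖² and zᵀQ*z ≥ q_m‖z‖² for all z ∈ ℝ². Let e₁, e₂ : [0,∞) → ℝⁿ be differentiable and satisfy, for all t ≥ 0, e₁'(t) = −k₁·φ₁ᵖᵏ(e₁(t)) + e₂(t) and e₂'(t) = −k₂·φ₂ᵖᵏ(e₁(t)) with k = k₃. Define V(t) := p₁₁‖φ₁ᵖᵏ(e₁(t))‖² + 2p₁₂⟨φ₁ᵖᵏ(e₁(t)),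 e₂(t)⟩ + p₂₂‖e₂(t)‖². Then at every t ≥ 0 with e₁(t) ≠ 0, V is differentiable and V'(t) ≤ −γ₁·V(t) − γ₂·V(t)^{1/p}, where γ₁ = k₃·q_m/p_M and γ₂ = q_m·p_m^{(p−1)/p}·p/(p_M·(3p−2)). -/
open scoped RealInnerProductSpace Matrix

/-- `φ₁ᵖᵏ(e) = k e + ‖e‖^(2(1-p)/(3p-2)) e` (value `0` at `e = 0`). -/
noncomputable def phi1 {n : ℕ} (p k : ℝ) (e : EuclideanSpace ℝ (Fin n)) :
    EuclideanSpace ℝ (Fin n) :=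
  k • e + (‖e‖ ^ (2 * (1 - p) / (3 * p - 2))) • e

/-- `φ₂ᵖᵏ(e) = k² e + (2k(2p-1)/(3p-2)) ‖e‖^(2(1-p)/(3p-2)) e
+ (p/(3p-2)) ‖e‖^(4(1-p)/(3p-2)) e` (value `0` at `e = 0`). -/
noncomputable def phi2 {n : ℕ} (p k : ℝ) (e : EuclideanSpace ℝ (Fin n)) :
    EuclideanSpace ℝ (Fin n) :=
  (k ^ 2) • e + ((2 * k * (2 * p - 1) / (3 * p - 2)) * ‖e‖ ^ (2 * (1 - p) / (3 * p - 2))) • e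
    + ((p / (3 * p - 2)) * ‖e‖ ^ (4 * (1 - p) / (3 * p - 2))) • e

/-- The strict Lyapunov function `V = ζᵀ P ζ`, `ζ = (φ₁ᵖᵏ(e₁), e₂)`, written out
with the entries `p₁₁, p₁₂, p₂₂` of `P*`. -/
noncomputable def lyapV {n : ℕ} (p k3 p11 p12 p22 : ℝ)
    (e1 e2 : ℝ → EuclideanSpace ℝ (Fin n)) (t : ℝ) : ℝ :=
  p11 * ‖phi1 p k3 (e1 t)‖ ^ 2 + 2 * p12 * ⟪phi1 p k3 (e1 t), e2 t⟫ +
    p22 * ‖e2 t‖ ^ 2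

/-- A binary quadratic form that is nonnegative on `ℝ²` is nonnegative on pairs of vectors. -/
theorem quadForm_nonneg_of_real {E : Type*} [NormedAddCommGroup E] [InnerProductSpace ℝ E]
    {a b c : ℝ} (h : ∀ x y : ℝ, 0 ≤ a * x ^ 2 + 2 * b * (x * y) + c * y ^ 2) (u v : E) :
    0 ≤ a * ‖u‖ ^ 2 + 2 * b * ⟪u, v⟫ + c * ‖v‖ ^ 2 := by
  have huv := abs_le.mp (abs_real_inner_le_norm u v)
  have h₁ := h ‖u‖ ‖v‖
  have h₂ := h ‖u‖ (-‖v‖)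
  rcases le_total 0 b with hb | hb
  · nlinarith [mul_le_mul_of_nonneg_left huv.1 hb]
  · nlinarith [mul_le_mul_of_nonpos_left huv.2 hb]

theorem phi1_eq_smul {n : ℕ} (p k : ℝ) (e : EuclideanSpace ℝ (Fin n)) :
    phi1 p k e = (k + ‖e‖ ^ (2 * (1 - p) / (3 * p - 2))) • e := by
  rw [phi1, add_smul]

/-- The two correction terms satisfy `φ₂ = (k + (p/(3p-2)) ‖e‖^(2(1-p)/(3p-2))) φ₁`. -/
theorem phi2_eq_smul_phi1 {n : ℕ} {p : ℝ} (hp : 3 * p - 2 ≠ 0) (k : ℝ)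
    {e : EuclideanSpace ℝ (Fin n)} (he : e ≠ 0) :
    phi2 p k e =
      (k + p / (3 * p - 2) * ‖e‖ ^ (2 * (1 - p) / (3 * p - 2))) • phi1 p k e := by
  have hsq : ‖e‖ ^ (4 * (1 - p) / (3 * p - 2)) =
      ‖e‖ ^ (2 * (1 - p) / (3 * p - 2)) * ‖e‖ ^ (2 * (1 - p) / (3 * p - 2)) := by
    rw [← Real.rpow_add (norm_pos_iff.mpr he)]
    congr 1
    ring
  rw [phi1_eq_smul, phi2, hsq, smul_smul, ← add_smul, ← add_smul]
  congr 1
  rw [mul_comm] at hp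
  field_simp
  ring

theorem HasDerivAt.norm_rpow_of_ne_zero {E : Type*} [NormedAddCommGroup E] [InnerProductSpace ℝ E]
    {f : ℝ → E} {f' : E} {t : ℝ} (a : ℝ) (hf : HasDerivAt f f' t) (h0 : f t ≠ 0) :
    HasDerivAt (fun s => ‖f s‖ ^ a) (a * ‖f t‖ ^ a * (⟪f t, f'⟫ / ‖f t‖ ^ 2)) t := by
  have hpos : 0 < ‖f t‖ := norm_pos_iff.mpr h0
  have hfun : (fun s => ‖f s‖ ^ a) = fun s => (‖f s‖ ^ 2) ^ (a / 2) := by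
    funext s
    rw [← Real.rpow_natCast, ← Real.rpow_mul (norm_nonneg _)]
    congr 1
    push_cast
    ring
  have hval : (‖f t‖ ^ 2) ^ (a / 2 - 1) = ‖f t‖ ^ a / ‖f t‖ ^ 2 := by
    rw [Real.rpow_sub_one (by positivity), ← congrFun hfun t]
  rw [hfun]
  refine (hf.norm_sq.rpow_const (p := a / 2) (Or.inl (by positivity))).congr_deriv ?_
  rw [hval]
  ring

theorem hasDerivAt_phi1 {n : ℕ} (p k : ℝ) {f : ℝ → EuclideanSpace ℝ (Fin n)}
    {f' : EuclideanSpace ℝ (Fin n)} {t : ℝ} (hf : HasDerivAt f f' t) (h0 : f t ≠ 0) :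
    HasDerivAt (fun s => phi1 p k (f s))
      ((k + ‖f t‖ ^ (2 * (1 - p) / (3 * p - 2))) • f' +
        (2 * (1 - p) / (3 * p - 2) * ‖f t‖ ^ (2 * (1 - p) / (3 * p - 2)) *
          (⟪f t, f'⟫ / ‖f t‖ ^ 2)) • f t) t := by
  simp only [phi1_eq_smul]
  exact ((hf.norm_rpow_of_ne_zero _ h0).const_add k).smul hf

/-- The weight `‖e‖^(2(1-p)/(3p-2))` turns `V` into a multiple of `V^(1/p)`. -/
theorem rpow_one_div_le_of_norm_phi1_le {n : ℕ} {p k c V : ℝ} (hp : 1 < p) (hk : 0 ≤ k)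
    (hc : 0 ≤ c) {e : EuclideanSpace ℝ (Fin n)} (he : e ≠ 0)
    (hV : c * ‖phi1 p k e‖ ^ 2 ≤ V) :
    c ^ ((p - 1) / p) * V ^ (1 / p) ≤ ‖e‖ ^ (2 * (1 - p) / (3 * p - 2)) * V := by
  have hs : 0 < ‖e‖ := norm_pos_iff.mpr he
  have h3 : p * 3 - 2 ≠ 0 := by linarith
  have hp0 : 0 < p := by linarith
  have hV0 : 0 ≤ V := le_trans (by positivity) hV
  set w := ‖e‖ ^ (2 * (1 - p) / (3 * p - 2)) with hw
  have hwpos : 0 < w := Real.rpow_pos_of_pos hs _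
  have hlow : c * (w * ‖e‖) ^ 2 ≤ V := by
    refine le_trans ?_ hV
    rw [phi1_eq_smul, norm_smul, Real.norm_of_nonneg (by positivity)]
    gcongr
    linarith
  have hinv : ((w * ‖e‖) ^ 2) ^ ((p - 1) / p) = w⁻¹ := by
    have hmul : w * ‖e‖ = ‖e‖ ^ (2 * (1 - p) / (3 * p - 2) + 1) := by
      rw [Real.rpow_add_one hs.ne']
    rw [hmul, ← Real.rpow_natCast, ← Real.rpow_mul hs.le, ← Real.rpow_mul hs.le, hw,
      ← Real.rpow_neg hs.le]
    congr 1
    push_cast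
    field_simp
    ring
  have hpow : c ^ ((p - 1) / p) * w⁻¹ ≤ V ^ ((p - 1) / p) := by
    rw [← hinv, ← Real.mul_rpow hc (by positivity)]
    exact Real.rpow_le_rpow (by positivity) hlow (div_nonneg (by linarith) hp0.le)
  have hsplit : V ^ ((p - 1) / p) * V ^ (1 / p) = V := by
    have hsum : (p - 1) / p + 1 / p = 1 := by
      field_simp
      ring
    rw [← Real.rpow_add' hV0 (by rw [hsum]; exact one_ne_zero), hsum, Real.rpow_one]
  calc c ^ ((p - 1) / p) * V ^ (1 / p)
      = w * (c ^ ((p - 1) / p) * w⁻¹ * V ^ (1 / p)) := by field_simp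
    _ ≤ w * (V ^ ((p - 1) / p) * V ^ (1 / p)) := by gcongr
    _ = w * V := by rw [hsplit]

/-- along the HC-FFTSD dynamics `e₁' = -k₁ φ₁(e₁) + e₂`,
`e₂' = -k₂ φ₂(e₁)`, at any `t ≥ 0` with `e₁(t) ≠ 0` the Lyapunov function
`V = ζᵀ P ζ` is differentiable and satisfies `V' ≤ -γ₁ V - γ₂ V^(1/p)`. -/
theorem hcfftsd_lyapunov_decay (n : ℕ) (hn : 1 ≤ n) (p k1 k2 k3 : ℝ)
    (hp : p ∈ Set.Ioo (1 : ℝ) 2) (hk1 : 0 < k1) (hk2 : 0 < k2) (hk3 : 0 < k3)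
    (p11 p12 p22 : ℝ) (Qstar : Matrix (Fin 2) (Fin 2) ℝ) (hQ : Qstar.PosDef)
    (hP : (!![p11, p12; p12, p22] : Matrix (Fin 2) (Fin 2) ℝ).PosDef)
    (hLyapEq : (!![-k1, 1; -k2, 0] : Matrix (Fin 2) (Fin 2) ℝ)ᵀ * !![p11, p12; p12, p22]
        + !![p11, p12; p12, p22] * !![-k1, 1; -k2, 0] = -Qstar)
    (pm pM qm : ℝ) (hpm : 0 < pm) (hpM : 0 < pM) (hqm : 0 < qm)
    (hPlow : ∀ z : Fin 2 → ℝ,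
      pm * (z 0 ^ 2 + z 1 ^ 2) ≤ z ⬝ᵥ ((!![p11, p12; p12, p22] : Matrix (Fin 2) (Fin 2) ℝ).mulVec z))
    (hPup : ∀ z : Fin 2 → ℝ,
      z ⬝ᵥ ((!![p11, p12; p12, p22] : Matrix (Fin 2) (Fin 2) ℝ).mulVec z) ≤ pM * (z 0 ^ 2 + z 1 ^ 2))
    (hQlow : ∀ z : Fin 2 → ℝ, qm * (z 0 ^ 2 + z 1 ^ 2) ≤ z ⬝ᵥ (Qstar.mulVec z))
    (e1 e2 : ℝ → EuclideanSpace ℝ (Fin n))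
    (hde1 : ∀ t : ℝ, 0 ≤ t → HasDerivAt e1 (-k1 • phi1 p k3 (e1 t) + e2 t) t)
    (hde2 : ∀ t : ℝ, 0 ≤ t → HasDerivAt e2 (-k2 • phi2 p k3 (e1 t)) t) :
    ∀ t : ℝ, 0 ≤ t → e1 t ≠ 0 →
      ∃ v : ℝ, HasDerivAt (lyapV p k3 p11 p12 p22 e1 e2) v t ∧
        v ≤ -(k3 * qm / pM) * lyapV p k3 p11 p12 p22 e1 e2 t
          - (qm * pm ^ ((p - 1) / p) * p / (pM * (3 * p - 2))) *
              (lyapV p k3 p11 p12 p22 e1 e2 t) ^ (1 / p) := by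
  intro t ht he
  obtain ⟨hp1, -⟩ := hp
  have h3 : 0 < 3 * p - 2 := by linarith
  have hq00 : Qstar 0 0 = 2 * k1 * p11 + 2 * k2 * p12 := by
    have h := congrFun (congrFun hLyapEq 0) 0
    simp [Matrix.mul_apply, Fin.sum_univ_two] at h
    linarith
  have hq01 : Qstar 0 1 = -p11 + k1 * p12 + k2 * p22 := by
    have h := congrFun (congrFun hLyapEq 0) 1
    simp [Matrix.mul_apply, Fin.sum_univ_two] at h
    linarith
  have hq10 : Qstar 1 0 = -p11 + k1 * p12 + k2 * p22 := by
    have h := congrFun (congrFun hLyapEq 1) 0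
    simp [Matrix.mul_apply, Fin.sum_univ_two] at h
    linarith
  have hq11 : Qstar 1 1 = -2 * p12 := by
    have h := congrFun (congrFun hLyapEq 1) 1
    simp [Matrix.mul_apply, Fin.sum_univ_two] at h
    linarith
  have hp12 : p12 ≤ 0 := by
    have h := hQlow ![0, 1]
    simp [Matrix.mulVec, dotProduct, Fin.sum_univ_two, hq11] at h
    linarith
  set V := lyapV p k3 p11 p12 p22 e1 e2 t with hVdef
  have hVlow : pm * (‖phi1 p k3 (e1 t)‖ ^ 2 + ‖e2 t‖ ^ 2) ≤ V := by
    have h := quadForm_nonneg_of_real (a := p11 - pm) (b := p12) (c := p22 - pm)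
      (fun x y => by
        have h := hPlow ![x, y]
        simp [Matrix.mulVec, dotProduct, Fin.sum_univ_two] at h
        linarith) (phi1 p k3 (e1 t)) (e2 t)
    rw [hVdef, lyapV]
    linarith
  have hVup : V ≤ pM * (‖phi1 p k3 (e1 t)‖ ^ 2 + ‖e2 t‖ ^ 2) := by
    have h := quadForm_nonneg_of_real (a := pM - p11) (b := -p12) (c := pM - p22)
      (fun x y => by
        have h := hPup ![x, y]
        simp [Matrix.mulVec, dotProduct, Fin.sum_univ_two] at h
        linarith) (phi1 p k3 (e1 t)) (e2 t)
    rw [hVdef, lyapV]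
    linarith
  have hQform := quadForm_nonneg_of_real (a := 2 * k1 * p11 + 2 * k2 * p12 - qm)
      (b := -p11 + k1 * p12 + k2 * p22) (c := -2 * p12 - qm)
      (fun x y => by
        have h := hQlow ![x, y]
        simp [Matrix.mulVec, dotProduct, Fin.sum_univ_two, hq00, hq01, hq10, hq11] at h
        linarith) (phi1 p k3 (e1 t)) (e2 t)
  have hVpow := rpow_one_div_le_of_norm_phi1_le (V := V) hp1 hk3.le hpm.le he
    (le_trans (by nlinarith [sq_nonneg ‖e2 t‖]) hVlow)
  have hd2 := hde2 t ht
  rw [phi2_eq_smul_phi1 h3.ne' k3 he] at hd2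
  have hdphi := hasDerivAt_phi1 p k3 (hde1 t ht) he
  have hdV := ((hdphi.norm_sq.const_mul p11).add
    ((hdphi.inner ℝ hd2).const_mul (2 * p12))).add (hd2.norm_sq.const_mul p22)
  refine ⟨_, hdV, ?_⟩
  have hs : 0 < ‖e1 t‖ := norm_pos_iff.mpr he
  have hcs : 0 ≤ ‖e2 t‖ ^ 2 - ⟪e1 t, e2 t⟫ ^ 2 / ‖e1 t‖ ^ 2 := by
    rw [sub_nonneg, div_le_iff₀ (by positivity), ← mul_pow, mul_comm]
    exact sq_le_sq' (abs_le.mp (abs_real_inner_le_norm _ _)).1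
      (abs_le.mp (abs_real_inner_le_norm _ _)).2
  set w := ‖e1 t‖ ^ (2 * (1 - p) / (3 * p - 2))
  have hw : 0 < w := Real.rpow_pos_of_pos hs _
  have hb : 0 < p / (3 * p - 2) := div_pos (by linarith) h3
  have ha : 2 * (1 - p) / (3 * p - 2) = p / (3 * p - 2) - 1 := by
    rw [div_sub_one h3.ne']
    ring
  have hb1 : p / (3 * p - 2) ≤ 1 := by
    rw [div_le_one h3]
    linarith
  set b := p / (3 * p - 2) with hbdef
  have hphi : phi1 p k3 (e1 t) = (k3 + w) • e1 t := phi1_eq_smul p k3 (e1 t)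
  have hnphi : ‖phi1 p k3 (e1 t)‖ ^ 2 = (k3 + w) ^ 2 * ‖e1 t‖ ^ 2 := by
    rw [hphi, norm_smul, mul_pow, Real.norm_eq_abs, sq_abs]
  have hiphi : ⟪phi1 p k3 (e1 t), e2 t⟫ = (k3 + w) * ⟪e1 t, e2 t⟫ := by
    rw [hphi, real_inner_smul_left]
  have hdecay : 0 ≤ (k3 + b * w) * ((2 * k1 * p11 + 2 * k2 * p12 - qm) * ‖phi1 p k3 (e1 t)‖ ^ 2 +
      2 * (-p11 + k1 * p12 + k2 * p22) * ⟪phi1 p k3 (e1 t), e2 t⟫ +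
      (-2 * p12 - qm) * ‖e2 t‖ ^ 2) := mul_nonneg (by positivity) hQform
  have hperp : 0 ≤ (-2 * p12) * ((1 - b) * w) *
      (‖e2 t‖ ^ 2 - ⟪e1 t, e2 t⟫ ^ 2 / ‖e1 t‖ ^ 2) :=
    mul_nonneg (mul_nonneg (by linarith) (mul_nonneg (by linarith) hw.le)) hcs
  have hbound : -(qm * (k3 + b * w)) * (‖phi1 p k3 (e1 t)‖ ^ 2 + ‖e2 t‖ ^ 2) ≤
      -(k3 * qm / pM) * V - (qm * pm ^ ((p - 1) / p) * p / (pM * (3 * p - 2))) * V ^ (1 / p) := by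
    have h₁ := mul_le_mul_of_nonneg_left hVup (show 0 ≤ qm * (k3 + b * w) / pM by positivity)
    have h₂ := mul_le_mul_of_nonneg_left hVpow (show 0 ≤ qm * b / pM by positivity)
    have h₃ : qm * pm ^ ((p - 1) / p) * p / (pM * (3 * p - 2)) * V ^ (1 / p) =
        qm * b / pM * (pm ^ ((p - 1) / p) * V ^ (1 / p)) := by
      rw [hbdef]
      field_simp
    have h₄ : qm * (k3 + b * w) / pM * (pM * (‖phi1 p k3 (e1 t)‖ ^ 2 + ‖e2 t‖ ^ 2)) =
        qm * (k3 + b * w) * (‖phi1 p k3 (e1 t)‖ ^ 2 + ‖e2 t‖ ^ 2) := by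
      field_simp
    have h₅ : qm * (k3 + b * w) / pM * V = k3 * qm / pM * V + qm * b / pM * (w * V) := by
      ring
    linarith
  refine le_trans (sub_nonneg.mp ?_) hbound
  refine (add_nonneg hdecay hperp).trans_eq ?_
  rw [hnphi, hiphi]
  simp only [hphi, ha, inner_add_left, inner_add_right, real_inner_smul_left,
    real_inner_smul_right, real_inner_self_eq_norm_sq, real_inner_comm (e1 t) (e2 t), smul_smul]
  field_simp
  ring
end

section
/- Fix n ≥ 1, p ∈ (1,2) and k₁, k₂, k₃ > 0. Let e₁, e₂ : [0,∞) → ℝⁿ be differentiable and satisfy, for all t ≥ 0, e₁'(t) = −k₁·φ₁ᵖᵏ(e₁(t)) + e₂(t) and e₂'(t) = −k₂·φ₂ᵖᵏ(e₁(t)) with k = k₃. Then the origin is reached in finite time: there exists T ≥ 0 such that e₁(t) = 0 and e₂(t) = 0 for all t ≥ T. -/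
/-- A nonnegative function with `W' ≤ -c W ^ γ`, `γ < 1`, vanishes after finite time. -/
theorem eventually_eq_zero_of_deriv_le_neg_rpow {W W' : ℝ → ℝ} {c γ : ℝ} (hc : 0 < c) (hγ1 : γ < 1) (hW0 : ∀ t, 0 ≤ t → 0 ≤ W t)
    (hW : ∀ t, 0 ≤ t → HasDerivAt W (W' t) t)
    (hle : ∀ t, 0 ≤ t → W' t ≤ -c * W t ^ γ) :
    ∃ T : ℝ, 0 ≤ T ∧ ∀ t, T ≤ t → W t = 0 := by
  have hanti : AntitoneOn W (Set.Ici 0) := by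
    refine antitoneOn_of_hasDerivWithinAt_nonpos (f' := W') (convex_Ici 0)
      (fun t ht => (hW t ht).continuousAt.continuousWithinAt) ?_ ?_ <;>
    · intro t ht
      have ht0 : 0 ≤ t := interior_subset ht
      first
        | exact (hW t ht0).hasDerivWithinAt
        | nlinarith [hle t ht0, Real.rpow_nonneg (hW0 t ht0) γ]
  obtain ⟨T, hT0, hT⟩ : ∃ T : ℝ, 0 ≤ T ∧ W T = 0 := by
    by_contra! hne
    have hpos : ∀ t, 0 ≤ t → 0 < W t := fun t ht => lt_of_le_of_ne (hW0 t ht) (hne t ht).symm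
    have hd : 0 < (1 - γ) * c := mul_pos (by linarith) hc
    have hder : ∀ t, 0 ≤ t → HasDerivAt (fun t => W t ^ (1 - γ) + (1 - γ) * c * t)
        (W' t * (1 - γ) * W t ^ (1 - γ - 1) + (1 - γ) * c) t := fun t ht => by
      simpa only [mul_one, id] using ((hW t ht).rpow_const (p := 1 - γ) (Or.inl (hne t ht))).fun_add
        ((hasDerivAt_id t).const_mul ((1 - γ) * c))
    have hmono : AntitoneOn (fun t => W t ^ (1 - γ) + (1 - γ) * c * t) (Set.Ici 0) := by
      refine antitoneOn_of_hasDerivWithinAt_nonpos (convex_Ici 0)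
        (fun t ht => (hder t ht).continuousAt.continuousWithinAt)
        (fun t ht => (hder t (interior_subset ht)).hasDerivWithinAt) ?_
      intro t ht
      have ht0 : 0 ≤ t := interior_subset ht
      have hmul : W t ^ γ * W t ^ (1 - γ - 1) = 1 := by
        rw [← Real.rpow_add (hpos t ht0)]
        simp
      have hbound := mul_le_mul_of_nonneg_right (hle t ht0)
        (Real.rpow_nonneg (hpos t ht0).le (1 - γ - 1))
      rw [mul_assoc, hmul] at hbound
      nlinarith
    have hT0 : 0 ≤ (W 0 ^ (1 - γ) + 1) / ((1 - γ) * c) :=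
      div_nonneg (by have := Real.rpow_nonneg (hW0 0 le_rfl) (1 - γ); linarith) hd.le
    have hlast := hmono (Set.mem_Ici.2 le_rfl) hT0 hT0
    simp only [mul_zero, add_zero, mul_div_cancel₀ _ hd.ne'] at hlast
    linarith [Real.rpow_nonneg (hW0 _ hT0) (1 - γ)]
  exact ⟨T, hT0, fun t ht => le_antisymm (hT ▸ hanti hT0 (hT0.trans ht) ht)
    (hW0 t (hT0.trans ht))⟩

section Scalar

variable {q k k₂ a b : ℝ}

theorem rpow_neg_mul_sq (ha : 0 ≤ a) (hq : q < 2) : a ^ (-q) * a ^ 2 = a ^ (2 - q) := by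
  rw [← Real.rpow_natCast a 2, ← Real.rpow_add' ha (by norm_num; linarith)]
  congr 1
  push_cast
  ring

theorem rpow_neg_sq (ha : 0 ≤ a) : (a ^ (-q)) ^ 2 = a ^ (-(2 * q)) := by
  rw [← Real.rpow_mul_natCast ha]
  congr 1
  push_cast
  ring

/-- The energy `(k₂ g(a)² + b²) / 2` with `g(a) = (k + a^(-q)) a`. -/
noncomputable def energy (q k k₂ a b : ℝ) : ℝ :=
  (k₂ * ((k + a ^ (-q)) ^ 2 * a ^ 2) + b ^ 2) / 2

theorem energy_nonneg (hk₂ : 0 < k₂) : 0 ≤ energy q k k₂ a b := by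
  unfold energy
  positivity

theorem rpow_le_energy (hq1 : q < 1) (hk : 0 < k) (hk₂ : 0 < k₂) (ha : 0 ≤ a) :
    k₂ / 2 * a ^ (2 - 2 * q) ≤ energy q k k₂ a b := by
  have hx := Real.rpow_nonneg ha (-q)
  have h1 : a ^ (2 - 2 * q) ≤ (k + a ^ (-q)) ^ 2 * a ^ 2 := by
    rw [← rpow_neg_mul_sq ha (by linarith), ← rpow_neg_sq ha]
    gcongr
    linarith
  unfold energy
  nlinarith [sq_nonneg b]

theorem le_energy_rpow_mul (hq0 : 0 < q) (hq1 : q < 1) (hk : 0 < k) (hk₂ : 0 < k₂)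
    (ha : 0 < a) :
    (1 - q) * (k₂ / 2) ^ (q / (2 - 2 * q)) ≤
      energy q k k₂ a b ^ (q / (2 - 2 * q)) * (k + (1 - q) * a ^ (-q)) := by
  have hne : 2 - 2 * q ≠ 0 := by linarith
  have hr : 0 ≤ q / (2 - 2 * q) := div_nonneg hq0.le (by linarith)
  have h1 := Real.rpow_le_rpow (by positivity) (rpow_le_energy (b := b) hq1 hk hk₂ ha.le) hr
  rw [Real.mul_rpow (by positivity) (by positivity), ← Real.rpow_mul ha.le,
    mul_div_cancel₀ _ hne] at h1
  have h2 : a ^ q * a ^ (-q) = 1 := by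
    rw [← Real.rpow_add ha]
    simp
  calc (1 - q) * (k₂ / 2) ^ (q / (2 - 2 * q))
      = ((k₂ / 2) ^ (q / (2 - 2 * q)) * a ^ q) * ((1 - q) * a ^ (-q)) := by
        linear_combination -((1 - q) * (k₂ / 2) ^ (q / (2 - 2 * q))) * h2
    _ ≤ _ := by
        have : 0 ≤ 1 - q := by linarith
        gcongr
        · exact Real.rpow_nonneg (energy_nonneg hk₂) _
        · linarith

theorem mul_le_energy_rpow (hq1 : q < 1) (hk : 0 < k) (hk₂ : 0 < k₂)
    (ha : 0 ≤ a) (hb : 0 ≤ b) :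
    a * b ≤ (2 / k₂) ^ (1 / (2 - 2 * q)) * 2 ^ (1 / 2 : ℝ) *
      energy q k k₂ a b ^ (1 + q / (2 - 2 * q)) := by
  have hpos : 0 < 2 - 2 * q := by linarith
  have hV : 0 ≤ energy q k k₂ a b := energy_nonneg hk₂
  have h1 : a ≤ (2 / k₂ * energy q k k₂ a b) ^ (1 / (2 - 2 * q)) := by
    rw [one_div, Real.le_rpow_inv_iff_of_pos ha (by positivity) hpos]
    have h := rpow_le_energy (b := b) hq1 hk hk₂ ha
    calc a ^ (2 - 2 * q) = 2 / k₂ * (k₂ / 2 * a ^ (2 - 2 * q)) := by field_simp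
      _ ≤ _ := by gcongr
  have h2 : b ≤ (2 * energy q k k₂ a b) ^ (1 / 2 : ℝ) := by
    rw [← Real.sqrt_eq_rpow]
    refine Real.le_sqrt_of_sq_le ?_
    unfold energy
    have : 0 ≤ k₂ * ((k + a ^ (-q)) ^ 2 * a ^ 2) := by positivity
    linarith
  rw [Real.mul_rpow (by positivity) hV] at h1 h2
  have he : 1 + q / (2 - 2 * q) = 1 / (2 - 2 * q) + 1 / 2 := by
    have hne : 1 - q ≠ 0 := by linarith
    rw [show 2 - 2 * q = 2 * (1 - q) by ring]
    field_simp
    ring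
  rw [he, Real.rpow_add' hV (by positivity)]
  calc a * b ≤ _ := mul_le_mul h1 h2 hb (by positivity)
    _ = _ := by ring

end Scalar

section Radial

variable {E : Type*} [NormedAddCommGroup E] [InnerProductSpace ℝ E]

theorem hasDerivAt_norm_rpow_comp {f : ℝ → E} {f' : E} {t s : ℝ} (hf : HasDerivAt f f' t)
    (hs : 1 < s) :
    HasDerivAt (fun t => ‖f t‖ ^ s) (s * ‖f t‖ ^ (s - 2) * inner ℝ (f t) f') t := by
  exact ((hasFDerivAt_norm_rpow (f t) hs).comp_hasDerivAt t hf).congr_deriv (by simp)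

theorem hasDerivAt_energy {q k k₂ t : ℝ} (hq1 : q < 1 / 2) {f g : ℝ → E} {f' g' : E}
    (hf : HasDerivAt f f' t) (hg : HasDerivAt g g' t) :
    HasDerivAt (fun t => energy q k k₂ ‖f t‖ ‖g t‖)
      (k₂ * ((k + ‖f t‖ ^ (-q)) * (k + (1 - q) * ‖f t‖ ^ (-q))) * inner ℝ (f t) f'
        + inner ℝ (g t) g') t := by
  have heq : (fun t => energy q k k₂ ‖f t‖ ‖g t‖) = fun t =>
      (k₂ * (k ^ 2 * ‖f t‖ ^ 2 + 2 * k * ‖f t‖ ^ (2 - q) + ‖f t‖ ^ (2 - 2 * q))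
        + ‖g t‖ ^ 2) / 2 := by
    funext t
    rw [energy, ← rpow_neg_mul_sq (norm_nonneg _) (by linarith),
      ← rpow_neg_mul_sq (norm_nonneg _) (by linarith : 2 * q < 2), ← rpow_neg_sq (norm_nonneg _)]
    ring
  rw [heq]
  refine ((((((hf.norm_sq).const_mul (k ^ 2)).add
    ((hasDerivAt_norm_rpow_comp hf (by linarith : 1 < 2 - q)).const_mul (2 * k))).add
    (hasDerivAt_norm_rpow_comp hf (by linarith : 1 < 2 - 2 * q))).const_mul k₂ |>.add hg.norm_sq).div_const 2).congr_deriv ?_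
  rw [show 2 - q - 2 = -q by ring, show 2 - 2 * q - 2 = -(2 * q) by ring,
    ← rpow_neg_sq (norm_nonneg _)]
  ring

/-- Finite-time stability of the radial differentiator with gains `k₁`, `k₂`. -/
theorem radial_differentiator_finite_time {q k k₁ k₂ : ℝ} (hq0 : 0 < q) (hq1 : q < 1 / 2)
    (hk : 0 < k) (hk₁ : 0 < k₁) (hk₂ : 0 < k₂) {e₁ e₂ : ℝ → E}
    (h₁ : ∀ t, 0 ≤ t → HasDerivAt e₁ (-k₁ • (k + ‖e₁ t‖ ^ (-q)) • e₁ t + e₂ t) t)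
    (h₂ : ∀ t, 0 ≤ t → HasDerivAt e₂
      (-k₂ • ((k + ‖e₁ t‖ ^ (-q)) * (k + (1 - q) * ‖e₁ t‖ ^ (-q))) • e₁ t) t) :
    ∃ T : ℝ, 0 ≤ T ∧ ∀ t, T ≤ t → e₁ t = 0 ∧ e₂ t = 0 := by
  have hr : 0 < q / (2 - 2 * q) := div_pos hq0 (by linarith)
  set r := q / (2 - 2 * q)
  set V : ℝ → ℝ := fun t => energy q k k₂ ‖e₁ t‖ ‖e₂ t‖ with hV
  have hV0 : ∀ t, 0 ≤ V t := fun t => energy_nonneg hk₂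
  set L := (2 / k₂) ^ (1 / (2 - 2 * q)) * (2 : ℝ) ^ (1 / 2 : ℝ)
  have hL : 0 < L := by positivity
  set m := (1 - q) * (k₂ / 2) ^ r
  have hm : 0 < m := mul_pos (by linarith) (by positivity)
  set M := (1 + r) * k₁ * k₂ * m
  have hM : 0 < M := by positivity
  obtain ⟨ε, hε, hεL, hεM⟩ : ∃ ε : ℝ, 0 < ε ∧ ε * L ≤ 1 / 2 ∧ ε * (k₁ ^ 2 / 2 + k₂) ≤ M / 2 := by
    refine ⟨min (1 / 2 / L) (M / 2 / (k₁ ^ 2 / 2 + k₂)), by positivity, ?_, ?_⟩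
    · exact (le_div_iff₀ hL).1 (min_le_left _ _)
    · exact (le_div_iff₀ (by positivity)).1 (min_le_right _ _)
  set W : ℝ → ℝ := fun t => V t ^ (1 + r) - ε * inner ℝ (e₁ t) (e₂ t) with hW
  have hcross : ∀ t, |ε * inner ℝ (e₁ t) (e₂ t)| ≤ V t ^ (1 + r) / 2 := fun t => by
    have hab := mul_le_energy_rpow (by linarith : q < 1) hk hk₂ (norm_nonneg (e₁ t))
      (norm_nonneg (e₂ t))
    rw [abs_mul, abs_of_pos hε]
    calc ε * |inner ℝ (e₁ t) (e₂ t)| ≤ ε * (L * V t ^ (1 + r)) := by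
          gcongr
          exact (abs_real_inner_le_norm _ _).trans hab
      _ = ε * L * V t ^ (1 + r) := by ring
      _ ≤ 1 / 2 * V t ^ (1 + r) := by
          gcongr
          exact Real.rpow_nonneg (hV0 t) _
      _ = _ := by ring
  have hWlow : ∀ t, V t ^ (1 + r) / 2 ≤ W t := fun t => by
    have := abs_le.1 (hcross t)
    simp only [hW]
    linarith
  have hWup : ∀ t, W t ≤ 2 * V t ^ (1 + r) := fun t => by
    have := abs_le.1 (hcross t)
    have := Real.rpow_nonneg (hV0 t) (1 + r)
    simp only [hW]
    linarith
  have hW0 : ∀ t, 0 ≤ W t := fun t =>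
    (div_nonneg (Real.rpow_nonneg (hV0 t) _) zero_le_two).trans (hWlow t)
  set c := min (M / k₂) ε
  have hc : 0 < c := by positivity
  have hderiv : ∀ t, 0 ≤ t → ∃ w, HasDerivAt W w t ∧ w ≤ -c * V t := fun t ht => by
    have hVd : HasDerivAt V _ t := hasDerivAt_energy (k := k) (k₂ := k₂) hq1 (h₁ t ht) (h₂ t ht)
    refine ⟨_, (hVd.rpow_const (p := 1 + r) (Or.inr (by linarith))).sub
      (((h₁ t ht).inner ℝ (h₂ t ht)).const_mul ε), ?_⟩
    set a := ‖e₁ t‖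
    set b := ‖e₂ t‖
    have ha : 0 ≤ a := norm_nonneg _
    set z := a ^ (-q)
    have hz : 0 ≤ z := Real.rpow_nonneg ha _
    set S := (k + z) ^ 2 * a ^ 2
    have hS : 0 ≤ S := by positivity
    have hVt : V t = (k₂ * S + b ^ 2) / 2 := rfl
    have hdiss : m * S ≤ V t ^ r * (k + (1 - q) * z) * S := by
      rcases ha.eq_or_lt with h0 | h0
      · simp [S, ← h0]
      · exact mul_le_mul_of_nonneg_right
          (le_energy_rpow_mul hq0 (by linarith) hk hk₂ h0) hS
    have hyoung : k₁ * (k + z) * inner ℝ (e₁ t) (e₂ t) ≤ k₁ ^ 2 / 2 * S + b ^ 2 / 2 := by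
      have h := real_inner_le_norm (e₁ t) (e₂ t)
      calc k₁ * (k + z) * inner ℝ (e₁ t) (e₂ t) ≤ k₁ * (k + z) * (a * b) := by gcongr
        _ ≤ _ := by nlinarith [sq_nonneg (k₁ * (k + z) * a - b)]
    have hrad : (k + z) * (k + (1 - q) * z) * a ^ 2 ≤ S := by
      have : (k + z) * (k + (1 - q) * z) ≤ (k + z) ^ 2 := by nlinarith [mul_nonneg hq0.le hz]
      exact mul_le_mul_of_nonneg_right this (sq_nonneg a)
    have hcV : c * V t ≤ M / 2 * S + ε / 2 * b ^ 2 := by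
      have hcM : c * k₂ ≤ M := (le_div_iff₀ hk₂).1 (min_le_left _ _)
      have hcε : c ≤ ε := min_le_right _ _
      rw [hVt]
      nlinarith [mul_le_mul_of_nonneg_right hcM hS,
        mul_le_mul_of_nonneg_right hcε (sq_nonneg b)]
    simp only [inner_add_left, inner_add_right, inner_smul_left, inner_smul_right,
      real_inner_self_eq_norm_sq, real_inner_comm (e₁ t) (e₂ t), add_sub_cancel_left,
      RCLike.conj_to_real, neg_smul, inner_neg_left, inner_neg_right]
    have key : M * S ≤ (1 + r) * k₁ * k₂ * (V t ^ r * (k + (1 - q) * z) * S) := by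
      calc M * S = (1 + r) * k₁ * k₂ * (m * S) := by ring
        _ ≤ _ := by gcongr
    have hy := mul_le_mul_of_nonneg_left hyoung hε.le
    have hR := mul_le_mul_of_nonneg_left hrad (mul_pos hε hk₂).le
    have hM' := mul_le_mul_of_nonneg_right hεM hS
    simp only [S] at *
    linarith
  choose! w hw hwle using hderiv
  have hγ : (1 + r)⁻¹ < 1 := inv_lt_one_of_one_lt₀ (by linarith)
  obtain ⟨T, hT0, hT⟩ := eventually_eq_zero_of_deriv_le_neg_rpow
    (c := c * (1 / 2) ^ (1 + r)⁻¹) (γ := (1 + r)⁻¹) (by positivity) hγ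
    (fun t _ => hW0 t) hw (fun t ht => by
      have h : (1 / 2 * W t) ^ (1 + r)⁻¹ ≤ V t := by
        rw [Real.rpow_inv_le_iff_of_pos (by have := hW0 t; positivity) (hV0 t) (by linarith)]
        linarith [hWup t]
      rw [Real.mul_rpow (by norm_num) (hW0 t)] at h
      nlinarith [hwle t ht])
  refine ⟨T, hT0, fun t ht => ?_⟩
  have hVz : V t = 0 := by
    have h := hWlow t
    rw [hT t ht] at h
    exact (Real.rpow_eq_zero (hV0 t) (by linarith : 1 + r ≠ 0)).1
      (le_antisymm (by linarith) (Real.rpow_nonneg (hV0 t) _))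
  have hz : 0 ≤ ‖e₁ t‖ ^ (-q) := by positivity
  have hp : 0 < (k + ‖e₁ t‖ ^ (-q)) ^ 2 := by positivity
  simp only [hV, energy] at hVz
  have hA : 0 ≤ k₂ * ((k + ‖e₁ t‖ ^ (-q)) ^ 2 * ‖e₁ t‖ ^ 2) := by positivity
  have hB := sq_nonneg ‖e₂ t‖
  have hA0 : k₂ * ((k + ‖e₁ t‖ ^ (-q)) ^ 2 * ‖e₁ t‖ ^ 2) = 0 := by linarith
  have hB0 : ‖e₂ t‖ ^ 2 = 0 := by linarith
  exact ⟨by simpa [hk₂.ne', hp.ne', pow_ne_zero_iff] using hA0, by simpa using hB0⟩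

end Radial

theorem phi1_eq {n : ℕ} (p k : ℝ) (e : EuclideanSpace ℝ (Fin n)) :
    phi1 p k e = (k + ‖e‖ ^ (-(2 * (p - 1) / (3 * p - 2)))) • e := by
  rw [phi1, add_smul, show 2 * (1 - p) / (3 * p - 2) = -(2 * (p - 1) / (3 * p - 2)) by ring]

theorem phi2_eq {n : ℕ} {p : ℝ} (hp : 3 * p - 2 ≠ 0) (k : ℝ) (e : EuclideanSpace ℝ (Fin n)) :
    phi2 p k e = ((k + ‖e‖ ^ (-(2 * (p - 1) / (3 * p - 2)))) *
      (k + (1 - 2 * (p - 1) / (3 * p - 2)) * ‖e‖ ^ (-(2 * (p - 1) / (3 * p - 2))))) • e := by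
  rw [phi2, ← add_smul, ← add_smul,
    show 2 * (1 - p) / (3 * p - 2) = -(2 * (p - 1) / (3 * p - 2)) by ring,
    show 4 * (1 - p) / (3 * p - 2) = -(2 * (2 * (p - 1) / (3 * p - 2))) by ring,
    ← rpow_neg_sq (norm_nonneg e)]
  congr 1
  have h : 2 * (p - 1) / (3 * p - 2) = 1 - p / (3 * p - 2) := by
    rw [eq_sub_iff_add_eq, ← add_div, div_eq_one_iff_eq hp]
    ring
  have h' : 2 * k * (2 * p - 1) / (3 * p - 2) = k * (1 + p / (3 * p - 2)) := by
    rw [div_eq_iff hp]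
    linear_combination -k * div_mul_cancel₀ p hp
  rw [h', h]
  ring

/-- fast finite-time stability of the HC-FFTSD: along
`e₁' = -k₁ φ₁ᵖᵏ(e₁) + e₂`, `e₂' = -k₂ φ₂ᵖᵏ(e₁)` (with `k = k₃`), the origin is
reached in finite time and the states stay there. -/
theorem hcfftsd_finite_time_stable (n : ℕ) (hn : 1 ≤ n) (p k1 k2 k3 : ℝ)
    (hp : p ∈ Set.Ioo (1 : ℝ) 2) (hk1 : 0 < k1) (hk2 : 0 < k2) (hk3 : 0 < k3)
    (e1 e2 : ℝ → EuclideanSpace ℝ (Fin n))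
    (hde1 : ∀ t : ℝ, 0 ≤ t → HasDerivAt e1 (-k1 • phi1 p k3 (e1 t) + e2 t) t)
    (hde2 : ∀ t : ℝ, 0 ≤ t → HasDerivAt e2 (-k2 • phi2 p k3 (e1 t)) t) :
    ∃ T : ℝ, 0 ≤ T ∧ ∀ t : ℝ, T ≤ t → e1 t = 0 ∧ e2 t = 0 := by
  have hpos : 0 < 3 * p - 2 := by linarith [hp.1]
  simp only [phi1_eq] at hde1
  simp only [phi2_eq hpos.ne'] at hde2
  refine radial_differentiator_finite_time (div_pos (by linarith [hp.1]) hpos) ?_ hk3 hk1 hk2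
    hde1 hde2
  rw [div_lt_iff₀ hpos]
  linarith [hp.2]
end

section
/- Fix n ≥ 1, p ∈ (1,2) and k > 0. For all e, μ ∈ ℝⁿ, ‖φ₂ᵖᵏ(e+μ) − φ₂ᵖᵏ(e)‖ ≤ k²·‖μ‖ + (2k(2p−1)/(3p−2))·2^{2(p−1)/(3p−2)}·‖μ‖^{p/(3p−2)} + (p/(3p−2))·2^{4(p−1)/(3p−2)}·‖μ‖^{(2−p)/(3p−2)}. -/
namespace HolderRadialPower

/-- Subadditivity of `t ↦ t ^ α`, in the form of Hölder continuity on the nonnegative reals. -/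
lemma sq_rpow_sub_rpow_le {α a b : ℝ} (hα : 0 < α) (hα' : α ≤ 1) (ha : 0 ≤ a) (hb : 0 ≤ b) :
    (a ^ α - b ^ α) ^ 2 ≤ ((a - b) ^ 2) ^ α := by
  wlog hab : b ≤ a generalizing a b
  · have h := this hb ha (le_of_not_ge hab)
    rwa [← neg_sub, neg_sq, ← neg_sub a b, neg_sq] at h
  have hsub : 0 ≤ a - b := sub_nonneg.2 hab
  have hadd := Real.rpow_add_le_add_rpow hsub hb hα.le hα'
  rw [sub_add_cancel] at hadd
  rw [← Real.rpow_pow_comm hsub]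
  exact pow_le_pow_left₀ (sub_nonneg.2 (Real.rpow_le_rpow hb hab hα.le)) (by linarith) 2

/-- Concavity of `t ↦ t ^ α` at the midpoint. -/
lemma rpow_add_rpow_le {α a b : ℝ} (hα : 0 < α) (hα' : α ≤ 1) (ha : 0 ≤ a) (hb : 0 ≤ b) :
    a ^ α + b ^ α ≤ 2 ^ (1 - α) * (a + b) ^ α := by
  have h := (Real.concaveOn_rpow hα.le hα').2 (Set.mem_Ici.2 ha) (Set.mem_Ici.2 hb)
    (by norm_num : (0 : ℝ) ≤ 1 / 2) (by norm_num : (0 : ℝ) ≤ 1 / 2) (by norm_num)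
  simp only [smul_eq_mul] at h
  rw [← mul_add (1 / 2 : ℝ) a b, one_div, Real.mul_rpow (by norm_num) (by positivity),
    Real.inv_rpow (by norm_num)] at h
  rw [Real.rpow_sub (by norm_num), Real.rpow_one, div_mul_eq_mul_div, mul_div_assoc,
    div_eq_inv_mul]
  linarith

lemma rpow_sub_one_mul_self {α a : ℝ} (hα : α ≠ 0) (ha : 0 ≤ a) :
    a ^ (α - 1) * a = a ^ α := by
  rcases ha.eq_or_lt with rfl | ha
  · simp [Real.zero_rpow hα]
  · rw [← Real.rpow_add_one ha.ne', sub_add_cancel]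

variable {E : Type*} [NormedAddCommGroup E] [InnerProductSpace ℝ E]

/-- The radial power map `x ↦ ‖x‖ ^ (α - 1) • x` is `α`-Hölder with constant `2 ^ (1 - α)`. -/
theorem norm_sub_le {α : ℝ} (hα : 0 < α) (hα' : α ≤ 1) (x y : E) :
    ‖‖x‖ ^ (α - 1) • x - ‖y‖ ^ (α - 1) • y‖ ≤ 2 ^ (1 - α) * ‖x - y‖ ^ α := by
  have ha := norm_nonneg x
  have hb := norm_nonneg y
  -- interpolate between the parallel and the antiparallel configuration
  obtain ⟨t, ht0, ht1, hinner⟩ : ∃ t : ℝ, 0 ≤ t ∧ 0 ≤ 1 - t ∧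
      inner ℝ x y = (2 * t - 1) * (‖x‖ * ‖y‖) := by
    have hcos := abs_le.1 (abs_real_inner_div_norm_mul_norm_le_one x y)
    refine ⟨(1 + inner ℝ x y / (‖x‖ * ‖y‖)) / 2, by linarith, by linarith, ?_⟩
    rcases eq_or_ne (‖x‖ * ‖y‖) 0 with h | h
    · rw [h, mul_zero]
      rcases mul_eq_zero.1 h with h | h <;> simp [norm_eq_zero.1 h]
    · linear_combination -(div_mul_cancel₀ (inner ℝ x y) h)
  have hnorm (z : E) : ‖‖z‖ ^ (α - 1) • z‖ = ‖z‖ ^ α := by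
    rw [norm_smul, Real.norm_of_nonneg (by positivity),
      rpow_sub_one_mul_self hα.ne' (norm_nonneg z)]
  have hlhs : ‖‖x‖ ^ (α - 1) • x - ‖y‖ ^ (α - 1) • y‖ ^ 2 =
      t * (‖x‖ ^ α - ‖y‖ ^ α) ^ 2 + (1 - t) * (‖x‖ ^ α + ‖y‖ ^ α) ^ 2 := by
    rw [norm_sub_sq_real, hnorm, hnorm, real_inner_smul_left, real_inner_smul_right, hinner,
      ← rpow_sub_one_mul_self hα.ne' ha, ← rpow_sub_one_mul_self hα.ne' hb]
    ring
  have hdist : ‖x - y‖ ^ 2 = t * (‖x‖ - ‖y‖) ^ 2 + (1 - t) * (‖x‖ + ‖y‖) ^ 2 := by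
    rw [norm_sub_sq_real, hinner]
    ring
  have hconc := (Real.concaveOn_rpow hα.le hα').2 (Set.mem_Ici.2 (sq_nonneg (‖x‖ - ‖y‖)))
    (Set.mem_Ici.2 (sq_nonneg (‖x‖ + ‖y‖))) ht0 ht1 (by ring)
  simp only [smul_eq_mul] at hconc
  rw [← hdist, ← Real.rpow_pow_comm (norm_nonneg (x - y)),
    ← Real.rpow_pow_comm (add_nonneg ha hb)] at hconc
  have hC : (1 : ℝ) ≤ (2 ^ (1 - α)) ^ 2 :=
    one_le_pow₀ (Real.one_le_rpow (by norm_num) (by linarith))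
  have hsub : (‖x‖ ^ α - ‖y‖ ^ α) ^ 2 ≤ (2 ^ (1 - α)) ^ 2 * ((‖x‖ - ‖y‖) ^ 2) ^ α :=
    (sq_rpow_sub_rpow_le hα hα' ha hb).trans (le_mul_of_one_le_left (by positivity) hC)
  have hadd : (‖x‖ ^ α + ‖y‖ ^ α) ^ 2 ≤ (2 ^ (1 - α)) ^ 2 * ((‖x‖ + ‖y‖) ^ α) ^ 2 := by
    rw [← mul_pow]
    exact pow_le_pow_left₀ (by positivity) (rpow_add_rpow_le hα hα' ha hb) 2
  refine (sq_le_sq₀ (norm_nonneg _) (by positivity)).1 ?_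
  calc _ = _ := hlhs
    _ ≤ t * ((2 ^ (1 - α)) ^ 2 * ((‖x‖ - ‖y‖) ^ 2) ^ α) +
        (1 - t) * ((2 ^ (1 - α)) ^ 2 * ((‖x‖ + ‖y‖) ^ α) ^ 2) := by gcongr
    _ = (2 ^ (1 - α)) ^ 2 *
        (t * ((‖x‖ - ‖y‖) ^ 2) ^ α + (1 - t) * ((‖x‖ + ‖y‖) ^ α) ^ 2) := by ring
    _ ≤ (2 ^ (1 - α)) ^ 2 * (‖x - y‖ ^ α) ^ 2 := by gcongr
    _ = _ := by ring

end HolderRadialPower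

/-- noise robustness of the second stage of the HC-FFTSD:
`‖φ₂ᵖᵏ(e+μ) - φ₂ᵖᵏ(e)‖ ≤ k² ‖μ‖ + (2k(2p-1)/(3p-2)) 2^(2(p-1)/(3p-2)) ‖μ‖^(p/(3p-2))
+ (p/(3p-2)) 2^(4(p-1)/(3p-2)) ‖μ‖^((2-p)/(3p-2))`. -/
theorem phi2_noise_bound (n : ℕ) (hn : 1 ≤ n) (p k : ℝ)
    (hp : p ∈ Set.Ioo (1 : ℝ) 2) (hk : 0 < k)
    (e μ : EuclideanSpace ℝ (Fin n)) :
    ‖phi2 p k (e + μ) - phi2 p k e‖ ≤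
      k ^ 2 * ‖μ‖ +
      (2 * k * (2 * p - 1) / (3 * p - 2)) * 2 ^ (2 * (p - 1) / (3 * p - 2)) *
        ‖μ‖ ^ (p / (3 * p - 2)) +
      (p / (3 * p - 2)) * 2 ^ (4 * (p - 1) / (3 * p - 2)) *
        ‖μ‖ ^ ((2 - p) / (3 * p - 2)) := by
  obtain ⟨hp1, hp2⟩ := hp
  have hd : 0 < 3 * p - 2 := by linarith
  have hα := HolderRadialPower.norm_sub_le (α := p / (3 * p - 2)) (by positivity)
    ((div_le_one hd).2 (by linarith)) (e + μ) e
  have hβ := HolderRadialPower.norm_sub_le (α := (2 - p) / (3 * p - 2))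
    (div_pos (by linarith) hd) ((div_le_one hd).2 (by linarith)) (e + μ) e
  rw [add_sub_cancel_left,
    show p / (3 * p - 2) - 1 = 2 * (1 - p) / (3 * p - 2) by linear_combination div_self hd.ne',
    show 1 - p / (3 * p - 2) = 2 * (p - 1) / (3 * p - 2) by linear_combination -(div_self hd.ne')] at hα
  rw [add_sub_cancel_left,
    show (2 - p) / (3 * p - 2) - 1 = 4 * (1 - p) / (3 * p - 2) by linear_combination div_self hd.ne',
    show 1 - (2 - p) / (3 * p - 2) = 4 * (p - 1) / (3 * p - 2) by linear_combination -(div_self hd.ne')] at hβ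
  have hA : 0 ≤ 2 * k * (2 * p - 1) / (3 * p - 2) :=
    div_nonneg (mul_nonneg (by positivity) (by linarith)) hd.le
  have hB : 0 ≤ p / (3 * p - 2) := by positivity
  have hsplit : phi2 p k (e + μ) - phi2 p k e = k ^ 2 • μ +
      (2 * k * (2 * p - 1) / (3 * p - 2)) • (‖e + μ‖ ^ (2 * (1 - p) / (3 * p - 2)) • (e + μ) -
        ‖e‖ ^ (2 * (1 - p) / (3 * p - 2)) • e) +
      (p / (3 * p - 2)) • (‖e + μ‖ ^ (4 * (1 - p) / (3 * p - 2)) • (e + μ) -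
        ‖e‖ ^ (4 * (1 - p) / (3 * p - 2)) • e) := by
    unfold phi2
    module
  rw [hsplit]
  refine norm_add₃_le.trans ?_
  rw [norm_smul, norm_smul, norm_smul, Real.norm_of_nonneg hA, Real.norm_of_nonneg hB,
    Real.norm_of_nonneg (sq_nonneg k), mul_assoc _ (2 ^ _) _, mul_assoc _ (2 ^ _) _]
  gcongr
end

section
/- Fix m > 0, p ∈ (1,2), and gains k_{t1}, k_{t2}, k_{t3} > 0 and κ_t > 1/2. Let A_t = [[−k_{t1}, 1],[−k_{t2}, 0]], let Q_t be a symmetric positive definite 2×2 real matrix, and let P_t be a symmetric positive definite solution of A_tᵀP_t + P_tA_t = −Q_t. Suppose p_m, p_M, q_m > 0 satisfy p_m‖z‖² ≤ zᵀP_t z ≤ p_M‖z‖² and zᵀQ_t z ≥ q_m‖z‖² for all z ∈ ℝ², and that k_{t3}·q_m/p_M − 1/(k_{t3}²·p_m) > 0. Let e_b, e_v, e_φ : [0,∞) → ℝ³ be differentiable and satisfy, for all t ≥ 0: e_b' = e_v; m·e_v' = −m·k_{t1}·φ₁ᵖᵏ(ψ_t) − m·κ_t·( ‖e_b‖^{2(1−p)/p}·H(e_b,(p−1)/p)·e_v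 + e_v ) + e_φ; e_φ' = −m·k_{t2}·φ₂ᵖᵏ(ψ_t); where k = k_{t3} and ψ_t := e_v + κ_t·( e_b + ‖e_b‖^{2(1−p)/p}·e_b ). Then there exists T ≥ 0 such that e_b(t) = 0, e_v(t) = 0 and e_φ(t) = 0 for all t ≥ T. -/
open scoped RealInnerProductSpace Matrix

/-- `H(x,c) v = v - (2c/‖x‖²) ⟨x,v⟩ x` (the action of
`H(x,c) = I - (2c/‖x‖²) x xᵀ` on `v`). -/
noncomputable def Hact {n : ℕ} (x : EuclideanSpace ℝ (Fin n)) (c : ℝ)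
    (v : EuclideanSpace ℝ (Fin n)) : EuclideanSpace ℝ (Fin n) :=
  v - ((2 * c / ‖x‖ ^ 2) * ⟪x, v⟫) • x

/-- `ψ = e_v + κ (e_b + ‖e_b‖^(2(1-p)/p) e_b)`. -/
noncomputable def psiV {n : ℕ} (p κ : ℝ) (eb ev : EuclideanSpace ℝ (Fin n)) :
    EuclideanSpace ℝ (Fin n) :=
  ev + κ • (eb + (‖eb‖ ^ (2 * (1 - p) / p)) • eb)

open Set Filter Topology

section Auxiliary

theorem le_of_frequently_right_le {h : ℝ → ℝ} {a b : ℝ} (hab : a ≤ b)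
    (hc : ContinuousOn h (Icc a b))
    (hr : ∀ x ∈ Ico a b, ∃ᶠ z in 𝓝[>] x, h z ≤ h x) : h b ≤ h a := by
  have hcl : IsClosed ({x | h x ≤ h a} ∩ Icc a b) := by
    have := hc.preimage_isClosed_of_isClosed isClosed_Icc (isClosed_Iic (a := h a))
    rwa [inter_comm] at this
  refine hcl.Icc_subset_of_forall_exists_gt (le_refl (h a)) ?_ (right_mem_Icc.2 hab)
  rintro x ⟨hx, hxab⟩ y hy
  obtain ⟨z, hz, hz'⟩ := ((hr x hxab).and_eventually (Ioc_mem_nhdsGT hy)).exists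
  exact ⟨z, le_trans hz hx, hz'⟩

theorem le_of_frequently_right_le_Ioo {h : ℝ → ℝ} {a b : ℝ} (hab : a < b)
    (hc : ContinuousOn h (Icc a b))
    (hr : ∀ x ∈ Ioo a b, ∃ᶠ z in 𝓝[>] x, h z ≤ h x) : h b ≤ h a := by
  have ht : Tendsto h (𝓝[>] a) (𝓝 (h a)) :=
    (hc a (left_mem_Icc.2 hab.le)).mono_left (by
      rw [← nhdsWithin_Ioc_eq_nhdsGT hab]
      exact nhdsWithin_mono _ Ioc_subset_Icc_self)
  refine ge_of_tendsto ht ?_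
  filter_upwards [Ioo_mem_nhdsGT hab] with x hx
  exact le_of_frequently_right_le hx.2.le (hc.mono (Icc_subset_Icc_left hx.1.le))
    fun y hy => hr y ⟨hx.1.trans_le hy.1, hy.2⟩

theorem exists_last_zero {E : Type*} [TopologicalSpace E] [T1Space E] [Zero E] {u : ℝ → E}
    {a b : ℝ} (hu : ContinuousOn u (Icc a b)) (hz : ∃ x ∈ Icc a b, u x = 0) :
    ∃ x ∈ Icc a b, u x = 0 ∧ ∀ y ∈ Ioc x b, u y ≠ 0 := by
  have hcl : IsClosed (Icc a b ∩ u ⁻¹' {0}) :=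
    hu.preimage_isClosed_of_isClosed isClosed_Icc isClosed_singleton
  obtain ⟨x, hx, hx0⟩ := hz
  have hbdd : BddAbove (Icc a b ∩ u ⁻¹' {0}) := ⟨b, fun y hy => hy.1.2⟩
  obtain ⟨hm, hm0⟩ := hcl.csSup_mem ⟨x, hx, hx0⟩ hbdd
  exact ⟨_, hm, hm0, fun y hy h0 =>
    (le_csSup hbdd ⟨⟨hm.1.trans hy.1.le, hy.2⟩, h0⟩).not_gt hy.1⟩

theorem eq_zero_of_frequently_right_decrease {W : ℝ → ℝ} {c T₀ : ℝ} (hc : 0 < c)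
    (hW : ContinuousOn W (Ici T₀)) (hnn : ∀ t, 0 ≤ W t)
    (hr : ∀ x, T₀ ≤ x → 0 < W x → ∃ᶠ z in 𝓝[>] x, W z + c * z ≤ W x + c * x) :
    ∃ T, T₀ ≤ T ∧ ∀ t, T ≤ t → W t = 0 := by
  refine ⟨T₀ + W T₀ / c + 1, by have := div_nonneg (hnn T₀) hc.le; linarith, fun t ht => ?_⟩
  by_contra hne
  have hpos : 0 < W t := lt_of_le_of_ne (hnn t) (Ne.symm hne)
  have hd := div_nonneg (hnn T₀) hc.le
  have hTt : T₀ < t := by linarith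
  have key : ∀ a, T₀ ≤ a → a < t → (∀ x ∈ Ioo a t, 0 < W x) →
      W t + c * t ≤ W a + c * a := fun a ha hat hp =>
    le_of_frequently_right_le_Ioo (h := fun x => W x + c * x) hat
      ((hW.mono fun x hx => ha.trans hx.1).add (by fun_prop))
      fun x hx => hr x (ha.trans hx.1.le) (hp x hx)
  by_cases hz : ∃ x ∈ Icc T₀ t, W x = 0
  · obtain ⟨a, ha, ha0, hlast⟩ := exists_last_zero (hW.mono fun x hx => hx.1) hz
    have hat : a < t := lt_of_le_of_ne ha.2 fun h => hne (h ▸ ha0)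
    have := key a ha.1 hat fun y hy =>
      lt_of_le_of_ne (hnn y) (Ne.symm (hlast y ⟨hy.1, hy.2.le⟩))
    nlinarith
  · push Not at hz
    have := key T₀ le_rfl hTt fun y hy =>
      lt_of_le_of_ne (hnn y) (Ne.symm (hz y ⟨hy.1.le, hy.2.le⟩))
    have h2 : c * (T₀ + W T₀ / c + 1) ≤ c * t := by gcongr
    have h3 : c * (T₀ + W T₀ / c + 1) = c * T₀ + W T₀ + c := by field_simp
    linarith

variable {F : Type*} [NormedAddCommGroup F] [InnerProductSpace ℝ F]

theorem norm_rpow_norm_smul {r : ℝ} (hr : r + 1 ≠ 0) (x : F) :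
    ‖‖x‖ ^ r • x‖ = ‖x‖ ^ (r + 1) := by
  rw [norm_smul, Real.norm_of_nonneg (by positivity)]
  rcases eq_or_ne x 0 with rfl | hx
  · simp [Real.zero_rpow hr]
  · rw [Real.rpow_add_one (norm_ne_zero_iff.2 hx)]

theorem continuous_rpow_norm_smul {r : ℝ} (hr : 0 < r + 1) :
    Continuous fun x : F => ‖x‖ ^ r • x := by
  refine continuous_iff_continuousAt.2 fun x => ?_
  rcases eq_or_ne x 0 with rfl | hx
  · rw [ContinuousAt, smul_zero, tendsto_zero_iff_norm_tendsto_zero]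
    simp_rw [norm_rpow_norm_smul hr.ne']
    have : Continuous fun x : F => ‖x‖ ^ (r + 1) :=
      continuous_norm.rpow_const fun _ => Or.inr hr.le
    simpa [Real.zero_rpow hr.ne'] using this.tendsto (0 : F)
  · exact (continuous_norm.continuousAt.rpow_const (Or.inl (norm_ne_zero_iff.2 hx))).smul
      continuousAt_id

theorem HasDerivWithinAt.norm_rpow {u : ℝ → F} {u' : F} {S : Set ℝ} {t : ℝ} (r : ℝ)
    (hu : HasDerivWithinAt u u' S t) (h0 : u t ≠ 0) :
    HasDerivWithinAt (fun s => ‖u s‖ ^ r) (r * ‖u t‖ ^ r / ‖u t‖ ^ 2 * ⟪u t, u'⟫) S t := by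
  have hn : 0 < ‖u t‖ := norm_pos_iff.2 h0
  have e : ∀ x : F, ∀ q : ℝ, (‖x‖ ^ 2) ^ q = ‖x‖ ^ (2 * q) := fun x q => by
    rw [Real.rpow_mul (norm_nonneg x), Real.rpow_two]
  have := hu.norm_sq.rpow_const (p := r / 2) (Or.inl (by positivity))
  simp only [e] at this
  have e2 : 2 * (r / 2) = r := by ring
  rw [e2] at this
  convert this using 1
  have : 2 * (r / 2 - 1) = r - 2 := by ring
  rw [this, Real.rpow_sub hn, Real.rpow_two]
  ring

theorem HasDerivWithinAt.rpow_norm_smul {u : ℝ → F} {u' : F} {S : Set ℝ} {t : ℝ} (r : ℝ)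
    (hu : HasDerivWithinAt u u' S t) (h0 : u t ≠ 0) :
    HasDerivWithinAt (fun s => ‖u s‖ ^ r • u s)
      (‖u t‖ ^ r • (u' + (r / ‖u t‖ ^ 2 * ⟪u t, u'⟫) • u t)) S t := by
  refine ((hu.norm_rpow r h0).smul hu).congr_deriv ?_
  rw [smul_add, smul_smul]
  congr 2
  ring

theorem HasDerivWithinAt.eventually_right_le {h : ℝ → ℝ} {h' x : ℝ}
    (hd : HasDerivWithinAt h h' (Ici x) x) (hneg : h' < 0) :
    ∀ᶠ z in 𝓝[>] x, h z ≤ h x := by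
  have := (hd.mono Ioi_subset_Ici_self).limsup_slope_le' (by simp) hneg
  filter_upwards [this, self_mem_nhdsWithin] with z hz hxz
  rw [slope_def_field, div_neg_iff] at hz
  have : 0 < z - x := sub_pos.2 hxz
  rcases hz with hz | hz <;> linarith

theorem HasDerivAt.eq_zero_of_frequently_right_eq_zero {u : ℝ → F} {u' : F} {t : ℝ}
    (hu : HasDerivAt u u' t) (hz : ∃ᶠ s in 𝓝[>] t, u s = 0) : u' = 0 := by
  by_contra hne
  have h := (hu.hasDerivWithinAt (s := Ioi t)).eventually_ne hne (c := 0)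
  rw [sdiff_singleton_eq_self self_notMem_Ioi] at h
  exact hz h

/-- The variable `ev + κ (eb + ‖eb‖^r eb)` is right differentiable with derivative `g`, also at the
zeros of `eb`, where `‖eb‖^r eb` itself need not be differentiable. -/
theorem hasDerivWithinAt_add_smul_rpow_norm {eb ev g : ℝ → F} {κ r : ℝ} (hκ : κ ≠ 0)
    (hr1 : 0 < r + 1) (hr0 : r < 0) (hg : ContinuousOn g (Ici 0))
    (hb : ∀ t, 0 ≤ t → HasDerivAt eb (ev t) t)
    (hv : ∀ t, 0 ≤ t → HasDerivAt ev (g t - κ • (ev t +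
      ‖eb t‖ ^ r • (ev t + (r / ‖eb t‖ ^ 2 * ⟪eb t, ev t⟫) • eb t))) t) :
    ∀ t, 0 ≤ t → HasDerivWithinAt (fun t => ev t + κ • (eb t + ‖eb t‖ ^ r • eb t))
      (g t) (Ici t) t := by
  set ψ : ℝ → F := fun t => ev t + κ • (eb t + ‖eb t‖ ^ r • eb t) with hψ
  have hbc : ContinuousOn eb (Ici 0) := fun t ht => (hb t ht).continuousAt.continuousWithinAt
  have hvc : ContinuousOn ev (Ici 0) := fun t ht => (hv t ht).continuousAt.continuousWithinAt
  have hψc : ContinuousOn ψ (Ici 0) :=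
    hvc.add ((hbc.add ((continuous_rpow_norm_smul hr1).comp_continuousOn hbc)).const_smul κ)
  have hoff : ∀ t, 0 ≤ t → eb t ≠ 0 → HasDerivAt ψ (g t) t := by
    intro t ht h0
    have h1 := (hb t ht).hasDerivWithinAt.rpow_norm_smul (S := univ) r h0
    rw [hasDerivWithinAt_univ] at h1
    refine ((hv t ht).add (((hb t ht).add h1).const_smul κ)).congr_deriv ?_
    abel
  have hiso : ∀ t, 0 ≤ t → (∀ᶠ s in 𝓝[>] t, eb s ≠ 0) →
      HasDerivWithinAt ψ (g t) (Ici t) t := by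
    intro t ht hev
    obtain ⟨u, hu, hut⟩ := (mem_nhdsGT_iff_exists_Ioo_subset).1 hev
    have hd : ∀ s ∈ Ioo t u, HasDerivAt ψ (g s) s := fun s hs =>
      hoff s (ht.trans hs.1.le) (hut hs)
    refine hasDerivWithinAt_Ici_of_tendsto_deriv (s := Ioo t u)
      (fun s hs => (hd s hs).differentiableAt.differentiableWithinAt)
      ((hψc t ht).mono fun s hs => ht.trans hs.1.le) (Ioo_mem_nhdsGT hu) ?_
    have : Tendsto g (𝓝[>] t) (𝓝 (g t)) :=
      (hg t ht).mono_left (nhdsWithin_mono _ fun s hs => ht.trans (le_of_lt hs))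
    refine this.congr' ?_
    filter_upwards [Ioo_mem_nhdsGT hu] with s hs using (hd s hs).deriv.symm
  have hev0 : ∀ t, 0 ≤ t → eb t = 0 → ev t = 0 := by
    intro t ht h0
    by_cases hev : ∀ᶠ s in 𝓝[>] t, eb s ≠ 0
    · have hf : HasDerivWithinAt (fun s => ‖eb s‖ ^ r • eb s)
          (κ⁻¹ • (g t - (g t - κ • (ev t +
            ‖eb t‖ ^ r • (ev t + (r / ‖eb t‖ ^ 2 * ⟪eb t, ev t⟫) • eb t)))) - ev t)
          (Ici t) t := by
        have := (((hiso t ht hev).sub (hv t ht).hasDerivWithinAt).const_smul κ⁻¹).sub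
          (hb t ht).hasDerivWithinAt
        convert this using 1
        funext s
        simp [hψ, inv_smul_smul₀ hκ]
      have hf' := (hasDerivWithinAt_iff_tendsto_slope' self_notMem_Ioi).1
        (hf.mono Ioi_subset_Ici_self)
      have hb' := (hasDerivWithinAt_iff_tendsto_slope' self_notMem_Ioi).1
        ((hb t ht).hasDerivWithinAt (s := Ioi t))
      have hn : Tendsto (fun s => ‖eb s‖ ^ (-r)) (𝓝[>] t) (𝓝 0) := by
        have h := ((hb t ht).continuousAt.norm.rpow_const
          (Or.inr (neg_pos.2 hr0).le)).tendsto
        rw [h0, norm_zero, Real.zero_rpow (neg_pos.2 hr0).ne'] at h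
        exact h.mono_left nhdsWithin_le_nhds
      have hlim := hn.smul hf'
      rw [zero_smul] at hlim
      refine tendsto_nhds_unique hb' (hlim.congr' ?_)
      filter_upwards [hev] with s hs
      have hs' : 0 < ‖eb s‖ := norm_pos_iff.2 hs
      have : ‖eb s‖ ^ (-r) * ‖eb s‖ ^ r = 1 := by
        rw [← Real.rpow_add hs']; simp
      simp only [slope_def_module, h0, smul_zero, sub_zero]
      rw [smul_comm, smul_smul (‖eb s‖ ^ (-r)), this, one_smul]
    · exact (hb t ht).eq_zero_of_frequently_right_eq_zero 
        ((not_eventually.1 hev).mono fun _ => not_not.1)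
  have hψ0 : ∀ t, 0 ≤ t → eb t = 0 → ψ t = 0 := fun t ht h0 => by
    simp [hψ, h0, hev0 t ht h0]
  intro t ht
  by_cases hev : ∀ᶠ s in 𝓝[>] t, eb s ≠ 0
  · exact hiso t ht hev
  by_cases h0 : eb t = 0
  swap
  · exact (hoff t ht h0).hasDerivWithinAt
  have hfr : ∃ᶠ s in 𝓝[>] t, eb s = 0 := 
    (not_eventually.1 hev).mono fun _ => not_not.1
  have hg0 : g t = 0 := by
    have := (hv t ht).eq_zero_of_frequently_right_eq_zero
      ((hfr.and_eventually self_mem_nhdsWithin).mono fun s hs =>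
        hev0 s (ht.trans (le_of_lt hs.2)) hs.1)
    simpa [h0, hev0 t ht h0] using this
  rw [hasDerivWithinAt_iff_isLittleO, Asymptotics.isLittleO_iff]
  intro ε hε
  have hgt : Tendsto g (𝓝[≥] t) (𝓝 0) := by
    rw [← hg0]
    exact (hg t ht).mono_left (nhdsWithin_mono _ (Ici_subset_Ici.2 ht))
  obtain ⟨u, hu, hut⟩ := (mem_nhdsGE_iff_exists_Ico_subset).1
    (hgt.norm.eventually (ge_mem_nhds (by simpa using hε)))
  filter_upwards [Ico_mem_nhdsGE hu] with s hs
  rw [hg0, smul_zero, sub_zero, hψ0 t ht h0, sub_zero]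
  obtain ⟨a, ha, ha0, hlast⟩ := exists_last_zero (b := s)
    (hbc.mono fun x (hx : x ∈ Icc t s) => ht.trans hx.1) ⟨t, left_mem_Icc.2 hs.1, h0⟩
  have ha' : 0 ≤ a := ht.trans ha.1
  have := norm_image_sub_le_of_norm_deriv_right_le_segment (a := a) (b := s) (C := ε)
    (hψc.mono fun x hx => ha'.trans hx.1) (f' := g) (fun x hx => by
      refine hiso x (ha'.trans hx.1) ?_
      filter_upwards [Ioo_mem_nhdsGT hx.2] with y hy
      exact hlast y ⟨hx.1.trans_lt hy.1, hy.2.le⟩)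
    (fun x hx => hut ⟨ha.1.trans hx.1, hx.2.trans hs.2⟩) s (right_mem_Icc.2 ha.2)
  rw [hψ0 a ha' ha0, sub_zero] at this
  refine this.trans ?_
  rw [Real.norm_of_nonneg (sub_nonneg.2 hs.1)]
  have := ha.1
  gcongr

theorem quadForm_inner_nonneg {a b c : ℝ}
    (h : ∀ x y : ℝ, 0 ≤ a * x ^ 2 + 2 * b * (x * y) + c * y ^ 2) (u v : F) :
    0 ≤ a * ‖u‖ ^ 2 + 2 * b * ⟪u, v⟫ + c * ‖v‖ ^ 2 := by
  have h1 := abs_le.1 (abs_real_inner_le_norm u v)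
  rcases le_total 0 b with hb | hb
  · have := h ‖u‖ (-‖v‖)
    nlinarith [mul_le_mul_of_nonneg_left h1.1 hb]
  · have := h ‖u‖ ‖v‖
    nlinarith [mul_le_mul_of_nonpos_left h1.2 hb]

/-- Decay of `P11 ‖φ‖² + 2 P12 ⟪φ, η⟫ + P22 ‖η‖²`, where `φ = (k + s) ψ` and `s = ‖ψ‖^(-β)`, along the
super-twisting vector field. -/
theorem superTwisting_quadForm_deriv_le {k1 k2 k β s P11 P12 P22 q : ℝ} (hk : 0 < k)
    (hβ0 : 0 ≤ β) (hβ1 : β < 1) (hs : 0 < s) (hq : 0 ≤ q)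
    (hQ : ∀ x y : ℝ, q * (x ^ 2 + y ^ 2) ≤ (2 * k1 * P11 + 2 * k2 * P12) * x ^ 2
      + 2 * (k1 * P12 + k2 * P22 - P11) * (x * y) + (-(2 * P12)) * y ^ 2)
    {ψ η φ g D η' : F} (hψ : ψ ≠ 0) (hφ : φ = (k + s) • ψ) (hg : g = -k1 • φ + η)
    (hD : D = k • g + s • (g + (-β / ‖ψ‖ ^ 2 * ⟪ψ, g⟫) • ψ))
    (hη' : η' = -(k2 * ((k + (1 - β) * s) * (k + s))) • ψ) :
    P11 * (2 * ⟪φ, D⟫) + 2 * P12 * (⟪φ, η'⟫ + ⟪D, η⟫) + P22 * (2 * ⟪η, η'⟫)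
      ≤ -((k + (1 - β) * s) * q * (‖φ‖ ^ 2 + ‖η‖ ^ 2)) := by
  have hR : 0 < ‖ψ‖ ^ 2 := by have := norm_pos_iff.2 hψ; positivity
  have hP12 : P12 ≤ 0 := by have := hQ 0 1; norm_num at this; linarith
  have hquad := quadForm_inner_nonneg (a := 2 * k1 * P11 + 2 * k2 * P12 - q)
    (b := k1 * P12 + k2 * P22 - P11) (c := -(2 * P12) - q)
    (fun x y => by linarith [hQ x y]) φ η
  have hcs : ⟪ψ, η⟫ ^ 2 ≤ ‖ψ‖ ^ 2 * ‖η‖ ^ 2 := by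
    rw [← mul_pow]
    exact sq_le_sq' (abs_le.1 (abs_real_inner_le_norm ψ η)).1 (real_inner_le_norm ψ η)
  have hN : 0 ≤ ‖η‖ ^ 2 - ⟪ψ, η⟫ ^ 2 / ‖ψ‖ ^ 2 := by
    rw [sub_nonneg, div_le_iff₀ hR]; linarith
  have hlam : 0 ≤ k + (1 - β) * s := by nlinarith
  have hφn : ‖φ‖ ^ 2 = (k + s) ^ 2 * ‖ψ‖ ^ 2 := by
    rw [hφ, norm_smul, mul_pow, Real.norm_eq_abs, sq_abs]
  have hφη : ⟪φ, η⟫ = (k + s) * ⟪ψ, η⟫ := by rw [hφ, real_inner_smul_left]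
  have hψg : ⟪ψ, g⟫ = -k1 * (k + s) * ‖ψ‖ ^ 2 + ⟪ψ, η⟫ := by
    rw [hg, hφ, inner_add_right, real_inner_smul_right, real_inner_smul_right,
      real_inner_self_eq_norm_sq]
    ring
  have hgη : ⟪g, η⟫ = -k1 * (k + s) * ⟪ψ, η⟫ + ‖η‖ ^ 2 := by
    rw [hg, hφ, inner_add_left, real_inner_smul_left, real_inner_smul_left,
      real_inner_self_eq_norm_sq]
    ring
  have hφD : ⟪φ, D⟫ = (k + s) * (k + (1 - β) * s) * ⟪ψ, g⟫ := by
    rw [hD, hφ, real_inner_smul_left, inner_add_right, real_inner_smul_right,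
      real_inner_smul_right, inner_add_right, real_inner_smul_right, real_inner_self_eq_norm_sq]
    field_simp
    ring
  have hDη : ⟪D, η⟫ = (k + s) * ⟪g, η⟫ - β * s / ‖ψ‖ ^ 2 * ⟪ψ, g⟫ * ⟪ψ, η⟫ := by
    rw [hD, inner_add_left, real_inner_smul_left, real_inner_smul_left, inner_add_left,
      real_inner_smul_left]
    ring
  have hφη' : ⟪φ, η'⟫ = -(k2 * ((k + (1 - β) * s) * (k + s))) * (k + s) * ‖ψ‖ ^ 2 := by
    rw [hη', hφ, real_inner_smul_left, real_inner_smul_right, real_inner_self_eq_norm_sq]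
    ring
  have hηη' : ⟪η, η'⟫ = -(k2 * ((k + (1 - β) * s) * (k + s))) * ⟪ψ, η⟫ := by
    rw [hη', real_inner_smul_right, real_inner_comm]
  have hid : P11 * (2 * ⟪φ, D⟫) + 2 * P12 * (⟪φ, η'⟫ + ⟪D, η⟫) + P22 * (2 * ⟪η, η'⟫)
      + (k + (1 - β) * s) * q * (‖φ‖ ^ 2 + ‖η‖ ^ 2)
      = -((k + (1 - β) * s) * ((2 * k1 * P11 + 2 * k2 * P12 - q) * ‖φ‖ ^ 2
        + 2 * (k1 * P12 + k2 * P22 - P11) * ⟪φ, η⟫ + (-(2 * P12) - q) * ‖η‖ ^ 2))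
        + 2 * P12 * (β * s) * (‖η‖ ^ 2 - ⟪ψ, η⟫ ^ 2 / ‖ψ‖ ^ 2) := by
    rw [hφD, hφη', hDη, hηη', hφn, hφη, hψg, hgη]
    field_simp
    ring
  have h1 := mul_nonneg hlam hquad
  have h2 : 2 * P12 * (β * s) * (‖η‖ ^ 2 - ⟪ψ, η⟫ ^ 2 / ‖ψ‖ ^ 2) ≤ 0 :=
    mul_nonpos_of_nonpos_of_nonneg
      (mul_nonpos_of_nonpos_of_nonneg (by linarith) (by positivity)) hN
  linarith

/-- Finite-time convergence of the multivariable super-twisting dynamics. -/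
theorem superTwisting_finiteTime {k1 k2 k β P11 P12 P22 pm pM q : ℝ} (hk : 0 < k)
    (hβ0 : 0 < β) (hβ1 : β < 1) (hpm : 0 < pm) (hpM : 0 < pM) (hq : 0 < q)
    (hPlow : ∀ x y : ℝ, pm * (x ^ 2 + y ^ 2) ≤ P11 * x ^ 2 + 2 * P12 * (x * y) + P22 * y ^ 2)
    (hPup : ∀ x y : ℝ, P11 * x ^ 2 + 2 * P12 * (x * y) + P22 * y ^ 2 ≤ pM * (x ^ 2 + y ^ 2))
    (hQ : ∀ x y : ℝ, q * (x ^ 2 + y ^ 2) ≤ (2 * k1 * P11 + 2 * k2 * P12) * x ^ 2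
      + 2 * (k1 * P12 + k2 * P22 - P11) * (x * y) + (-(2 * P12)) * y ^ 2)
    {ψ η : ℝ → F} (hψc : ContinuousOn ψ (Ici 0)) (hηc : ContinuousOn η (Ici 0))
    (hψ : ∀ t, 0 ≤ t → HasDerivWithinAt ψ
      (-k1 • (k + ‖ψ t‖ ^ (-β)) • ψ t + η t) (Ici t) t)
    (hη : ∀ t, 0 ≤ t → HasDerivWithinAt η
      (-(k2 * ((k + (1 - β) * ‖ψ t‖ ^ (-β)) * (k + ‖ψ t‖ ^ (-β)))) • ψ t) (Ici t) t) :
    ∃ T, 0 ≤ T ∧ ∀ t, T ≤ t → ψ t = 0 ∧ η t = 0 := by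
  set φ : ℝ → F := fun t => k • ψ t + ‖ψ t‖ ^ (-β) • ψ t with hφdef
  have hφ : ∀ t, φ t = (k + ‖ψ t‖ ^ (-β)) • ψ t := fun t => (add_smul _ _ _).symm
  set V : ℝ → ℝ := fun t => P11 * ‖φ t‖ ^ 2 + 2 * P12 * ⟪φ t, η t⟫ + P22 * ‖η t‖ ^ 2 with hV
  have hVlow : ∀ t, pm * (‖φ t‖ ^ 2 + ‖η t‖ ^ 2) ≤ V t := fun t => by
    have := quadForm_inner_nonneg (a := P11 - pm) (b := P12) (c := P22 - pm)
      (fun x y => by linarith [hPlow x y]) (φ t) (η t)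
    simp only [hV]; linarith
  have hVup : ∀ t, V t ≤ pM * (‖φ t‖ ^ 2 + ‖η t‖ ^ 2) := fun t => by
    have := quadForm_inner_nonneg (a := pM - P11) (b := -P12) (c := pM - P22)
      (fun x y => by linarith [hPup x y]) (φ t) (η t)
    simp only [hV]; linarith
  have hVnn : ∀ t, 0 ≤ V t := fun t => le_trans (by positivity) (hVlow t)
  have hφc : ContinuousOn φ (Ici 0) := (hψc.const_smul k).add
    ((continuous_rpow_norm_smul (by linarith)).comp_continuousOn hψc)
  have hVc : ContinuousOn V (Ici 0) :=
    ((continuousOn_const.mul (hφc.norm.pow 2)).add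
      (continuousOn_const.mul (hφc.inner hηc))).add (continuousOn_const.mul (hηc.norm.pow 2))
  set γ : ℝ := β / (2 * (1 - β)) with hγ
  have hγ0 : 0 < γ := div_pos hβ0 (by linarith)
  have hγβ : 2 * (1 - β) * γ = β := by
    rw [hγ]; field_simp [(by linarith : (1 - β) ≠ 0)]
  have hWc : ContinuousOn (fun t => V t ^ γ) (Ici 0) :=
    hVc.rpow_const fun _ _ => Or.inr hγ0.le
  set c : ℝ := γ * (1 - β) * (q / pM) * pm ^ γ with hc
  have hc0 : 0 < c := by
    have : 0 < 1 - β := by linarith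
    positivity
  have hφne : ∀ t, ψ t ≠ 0 → ‖ψ t‖ ^ (1 - β) ≤ ‖φ t‖ := fun t h0 => by
    have hn : 0 < ‖ψ t‖ := norm_pos_iff.2 h0
    rw [hφ, norm_smul, Real.norm_of_nonneg (by positivity), add_mul,
      ← Real.rpow_add_one hn.ne', neg_add_eq_sub]
    have := mul_pos hk hn
    linarith
  have hVpos : ∀ t, ψ t ≠ 0 → 0 < V t := fun t h0 => by
    have hn : 0 < ‖φ t‖ :=
      (Real.rpow_pos_of_pos (norm_pos_iff.2 h0) _).trans_le (hφne t h0)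
    exact lt_of_lt_of_le (by positivity) (hVlow t)
  have hdecr : ∀ t, 0 ≤ t → ψ t ≠ 0 →
      ∀ᶠ z in 𝓝[>] t, V z ^ γ + c / 2 * z ≤ V t ^ γ + c / 2 * t := by
    intro t ht h0
    have hn : 0 < ‖ψ t‖ := norm_pos_iff.2 h0
    have hs : 0 < ‖ψ t‖ ^ (-β) := Real.rpow_pos_of_pos hn _
    have hφd := ((hψ t ht).const_smul k).add ((hψ t ht).rpow_norm_smul (-β) h0)
    obtain ⟨d, hVd, hle⟩ : ∃ d, HasDerivWithinAt V d (Ici t) t ∧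
        d ≤ -((k + (1 - β) * ‖ψ t‖ ^ (-β)) * q * (‖φ t‖ ^ 2 + ‖η t‖ ^ 2)) :=
      ⟨_, ((hφd.norm_sq.const_mul P11).add ((hφd.inner ℝ (hη t ht)).const_mul
        (2 * P12))).add ((hη t ht).norm_sq.const_mul P22),
        superTwisting_quadForm_deriv_le hk hβ0.le hβ1 hs hq.le hQ h0 (hφ t)
          (congrArg (fun x => -k1 • x + η t) (hφ t).symm) rfl rfl⟩
    have hWd := (hVd.rpow_const (p := γ) (Or.inl (hVpos t h0).ne')).add
      ((hasDerivWithinAt_id t (Ici t)).const_mul (c / 2))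
    refine HasDerivWithinAt.eventually_right_le hWd ?_
    refine lt_of_le_of_lt (b := -c + c / 2) (add_le_add ?_ (by simp)) (by linarith)
    have hV' := hle.trans
      (c := -((1 - β) * ‖ψ t‖ ^ (-β) * (q / pM) * V t)) (by
        rw [neg_le_neg_iff]
        have h1 : q / pM * V t ≤ q * (‖φ t‖ ^ 2 + ‖η t‖ ^ 2) := by
          rw [div_mul_eq_mul_div, div_le_iff₀ hpM]
          nlinarith [mul_le_mul_of_nonneg_left (hVup t) hq.le]
        rw [mul_assoc _ (q / pM), mul_assoc _ q]
        refine mul_le_mul (by linarith) h1 (by have := hVnn t; positivity) ?_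
        have : 0 < 1 - β := by linarith
        positivity)
    have hpow : pm ^ γ ≤ ‖ψ t‖ ^ (-β) * V t ^ γ := by
      have h1 : pm * (‖ψ t‖ ^ (1 - β)) ^ 2 ≤ V t := by
        refine le_trans ?_ (hVlow t)
        have := pow_le_pow_left₀ (by positivity) (hφne t h0) 2
        have h2 := sq_nonneg ‖η t‖
        gcongr
        linarith
      have h2 := Real.rpow_le_rpow (by positivity) h1 hγ0.le
      have h3 : ((‖ψ t‖ ^ (1 - β)) ^ 2) ^ γ = ‖ψ t‖ ^ β := by
        rw [← Real.rpow_two, ← Real.rpow_mul hn.le, ← Real.rpow_mul hn.le]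
        congr 1
        linarith
      rw [Real.mul_rpow hpm.le (by positivity), h3] at h2
      calc pm ^ γ = ‖ψ t‖ ^ (-β) * (pm ^ γ * ‖ψ t‖ ^ β) := by
            rw [mul_left_comm, ← Real.rpow_add hn]; simp
        _ ≤ _ := by gcongr
    have hVγ : V t * V t ^ (γ - 1) = V t ^ γ := by
      rw [mul_comm, ← Real.rpow_add_one (hVpos t h0).ne', sub_add_cancel]
    calc _ ≤ -((1 - β) * ‖ψ t‖ ^ (-β) * (q / pM) * V t) * γ * V t ^ (γ - 1) := by
          have : 0 ≤ V t ^ (γ - 1) := Real.rpow_nonneg (hVnn t) _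
          gcongr
      _ = -(γ * (1 - β) * (q / pM) * (‖ψ t‖ ^ (-β) * V t ^ γ)) := by rw [← hVγ]; ring
      _ ≤ -c := by
          have : 0 < 1 - β := by linarith
          rw [hc]
          gcongr
  obtain ⟨T, hT, hz⟩ := eq_zero_of_frequently_right_decrease (half_pos hc0) hWc
    (fun t => Real.rpow_nonneg (hVnn t) γ) (T₀ := 0) (by
      intro x hx hpos
      by_cases h0 : ψ x = 0
      · have hηx : η x ≠ 0 := by
          intro hη0
          simp [hV, hφdef, h0, hη0, Real.zero_rpow hγ0.ne'] at hpos
        have hne := (((hψ x hx).mono Ioi_subset_Ici_self).eventually_ne (c := 0)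
          (by simpa [h0] using hηx))
        rw [sdiff_singleton_eq_self self_notMem_Ioi] at hne
        obtain ⟨u, hu, hxu⟩ := (mem_nhdsGT_iff_exists_Ioo_subset).1 hne
        refine Filter.Eventually.frequently ?_
        filter_upwards [Ioo_mem_nhdsGT hu] with z hz
        exact le_of_frequently_right_le_Ioo (h := fun z => V z ^ γ + c / 2 * z) hz.1
          ((hWc.mono fun y hy => hx.trans hy.1).add (by fun_prop))
          fun y hy => (hdecr y (hx.trans hy.1.le) (hxu ⟨hy.1, hy.2.trans hz.2⟩)).frequently
      · exact (hdecr x hx h0).frequently)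
  refine ⟨T, hT, fun t ht => ?_⟩
  have hV0 : V t = 0 := ((Real.rpow_eq_zero (hVnn t) hγ0.ne').1 (hz t ht))
  refine ⟨?_, ?_⟩
  · by_contra h
    exact (hVpos t h).ne' hV0
  · have h1 := hVlow t
    rw [hV0] at h1
    have h2 : ‖η t‖ ^ 2 ≤ 0 := by nlinarith [sq_nonneg ‖φ t‖, sq_nonneg ‖η t‖]
    simpa using le_antisymm h2 (sq_nonneg _)

/-- Finite-time convergence of `u' = -κ (u + ‖u‖^r u)` for `-1 < r < 0`. -/
theorem finiteTime_of_hasDerivAt_neg_rpow_norm {κ r T₀ : ℝ} (hκ : 0 < κ) (hr0 : r < 0)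
    {u : ℝ → F}
    (hu : ∀ t, T₀ ≤ t → HasDerivAt u (-(κ • (u t + ‖u t‖ ^ r • u t))) t) :
    ∃ T, T₀ ≤ T ∧ ∀ t, T ≤ t → u t = 0 := by
  have huc : ContinuousOn u (Ici T₀) := fun t ht => (hu t ht).continuousAt.continuousWithinAt
  obtain ⟨T, hT, hz⟩ := eq_zero_of_frequently_right_decrease (W := fun t => ‖u t‖ ^ (-r))
    (c := -r * κ / 2) (T₀ := T₀) (by nlinarith)
    (huc.norm.rpow_const fun _ _ => Or.inr (by linarith)) (fun t => by positivity) (by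
      intro x hx hpos
      have h0 : u x ≠ 0 := by
        intro h
        simp [h, Real.zero_rpow (neg_pos.2 hr0).ne'] at hpos
      have hn : 0 < ‖u x‖ := norm_pos_iff.2 h0
      have hd := ((hu x hx).hasDerivWithinAt.norm_rpow (S := Ici x) (-r) h0).add
        ((hasDerivWithinAt_id x (Ici x)).const_mul (-r * κ / 2))
      refine (HasDerivWithinAt.eventually_right_le hd ?_).frequently
      have h1 : ‖u x‖ ^ (-r) * ‖u x‖ ^ r = 1 := by rw [← Real.rpow_add hn]; simp
      rw [inner_neg_right, real_inner_smul_right, inner_add_right, real_inner_smul_right,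
        real_inner_self_eq_norm_sq]
      have h2 : -r * ‖u x‖ ^ (-r) / ‖u x‖ ^ 2 * -(κ * (‖u x‖ ^ 2 + ‖u x‖ ^ r * ‖u x‖ ^ 2))
          = r * κ * (‖u x‖ ^ (-r) + ‖u x‖ ^ (-r) * ‖u x‖ ^ r) := by
        field_simp
      rw [h2, h1]
      have h3 : r * κ < 0 := mul_neg_of_neg_of_pos hr0 hκ
      nlinarith [mul_nonneg_of_nonpos_of_nonpos h3.le (neg_nonpos.2 hpos.le)])
  exact ⟨T, hT, fun t ht => norm_eq_zero.1
    ((Real.rpow_eq_zero (norm_nonneg _) (neg_pos.2 hr0).ne').1 (hz t ht))⟩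

end Auxiliary

/-- fast finite-time stability of the translational ESO error
dynamics on `ℝ³` for a rigid body of mass `m` under a constant disturbance
force: `e_b' = e_v`, `m e_v' = -m k_{t1} φ₁(ψ_t) - m κ_t (‖e_b‖^(2(1-p)/p)
H(e_b,(p-1)/p) e_v + e_v) + e_φ`, `e_φ' = -m k_{t2} φ₂(ψ_t)`. -/
theorem translational_eso_ffts (m p kt1 kt2 kt3 κt : ℝ)
    (hm : 0 < m) (hp : p ∈ Set.Ioo (1 : ℝ) 2)
    (h1 : 0 < kt1) (h2 : 0 < kt2) (h3 : 0 < kt3) (hκ : 1 / 2 < κt)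
    (Qt Pt : Matrix (Fin 2) (Fin 2) ℝ) (hQt : Qt.PosDef) (hPt : Pt.PosDef)
    (hLyapEq : (!![-kt1, 1; -kt2, 0] : Matrix (Fin 2) (Fin 2) ℝ)ᵀ * Pt
        + Pt * !![-kt1, 1; -kt2, 0] = -Qt)
    (pm pM qm : ℝ) (hpm : 0 < pm) (hpM : 0 < pM) (hqm : 0 < qm)
    (hPlow : ∀ z : Fin 2 → ℝ, pm * (z 0 ^ 2 + z 1 ^ 2) ≤ z ⬝ᵥ Pt.mulVec z)
    (hPup : ∀ z : Fin 2 → ℝ, z ⬝ᵥ Pt.mulVec z ≤ pM * (z 0 ^ 2 + z 1 ^ 2))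
    (hQlow : ∀ z : Fin 2 → ℝ, qm * (z 0 ^ 2 + z 1 ^ 2) ≤ z ⬝ᵥ Qt.mulVec z)
    (hgain : 0 < kt3 * qm / pM - 1 / (kt3 ^ 2 * pm))
    (eb ev eφ : ℝ → EuclideanSpace ℝ (Fin 3))
    (hdb : ∀ t : ℝ, 0 ≤ t → HasDerivAt eb (ev t) t)
    (hdv : ∀ t : ℝ, 0 ≤ t → HasDerivAt ev
      (m⁻¹ • (-(m * kt1) • phi1 p kt3 (psiV p κt (eb t) (ev t))
        - (m * κt) • ((‖eb t‖ ^ (2 * (1 - p) / p)) •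
            Hact (eb t) ((p - 1) / p) (ev t) + ev t)
        + eφ t)) t)
    (hdφ : ∀ t : ℝ, 0 ≤ t → HasDerivAt eφ
      (-(m * kt2) • phi2 p kt3 (psiV p κt (eb t) (ev t))) t) :
    ∃ T : ℝ, 0 ≤ T ∧ ∀ t : ℝ, T ≤ t → eb t = 0 ∧ ev t = 0 ∧ eφ t = 0 := by
  obtain ⟨hp1, hp2⟩ := hp
  have h3p : 0 < 3 * p - 2 := by linarith
  have h3p' : 3 * p - 2 ≠ 0 := h3p.ne'
  set β : ℝ := 2 * (p - 1) / (3 * p - 2) with hβ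
  have hβ0 : 0 < β := div_pos (by linarith) h3p
  have hβ1 : β < 1 := by rw [hβ, div_lt_one h3p]; linarith
  have hβe : 2 * (1 - p) / (3 * p - 2) = -β := by rw [hβ]; ring
  have hβe2 : 4 * (1 - p) / (3 * p - 2) = -β * 2 := by rw [hβ]; ring
  have hβD : β * (3 * p - 2) = 2 * (p - 1) := div_mul_cancel₀ _ h3p'
  have hβc1 : p / (3 * p - 2) = 1 - β := by
    rw [div_eq_iff h3p']; linear_combination hβD
  have hβc2 : 2 * kt3 * (2 * p - 1) / (3 * p - 2) = kt3 * (2 - β) := by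
    rw [div_eq_iff h3p']; linear_combination kt3 * hβD
  set r : ℝ := 2 * (1 - p) / p with hr
  have hr0 : r < 0 := div_neg_of_neg_of_pos (by linarith) (by linarith)
  have hr1 : 0 < r + 1 := by
    have : r + 1 = (2 - p) / p := by rw [hr]; field_simp; ring
    rw [this]; exact div_pos (by linarith) (by linarith)
  have hrc : -(2 * ((p - 1) / p)) = r := by rw [hr]; ring
  have hκ0 : 0 < κt := by linarith
  set ψ : ℝ → EuclideanSpace ℝ (Fin 3) := fun t => psiV p κt (eb t) (ev t) with hψ
  have hψdef : ψ = fun t => ev t + κt • (eb t + ‖eb t‖ ^ r • eb t) := rfl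
  have hφ1 : ∀ x : EuclideanSpace ℝ (Fin 3),
      phi1 p kt3 x = (kt3 + ‖x‖ ^ (-β)) • x := fun x => by
    rw [phi1, hβe, add_smul]
  have hφ2 : ∀ x : EuclideanSpace ℝ (Fin 3),
      phi2 p kt3 x = ((kt3 + (1 - β) * ‖x‖ ^ (-β)) * (kt3 + ‖x‖ ^ (-β))) • x := fun x => by
    rw [phi2, hβe, hβe2, hβc1, hβc2, Real.rpow_mul (norm_nonneg x), Real.rpow_two, ← add_smul,
      ← add_smul]
    congr 1
    ring
  have hbc : ContinuousOn eb (Ici 0) := fun t ht => (hdb t ht).continuousAt.continuousWithinAt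
  have hvc : ContinuousOn ev (Ici 0) := fun t ht => (hdv t ht).continuousAt.continuousWithinAt
  have hφc : ContinuousOn eφ (Ici 0) := fun t ht => (hdφ t ht).continuousAt.continuousWithinAt
  have hψc : ContinuousOn ψ (Ici 0) := by
    rw [hψdef]
    exact hvc.add ((hbc.add ((continuous_rpow_norm_smul hr1).comp_continuousOn hbc)).const_smul κt)
  have hψd := hasDerivWithinAt_add_smul_rpow_norm
    (g := fun t => -kt1 • (kt3 + ‖ψ t‖ ^ (-β)) • ψ t + m⁻¹ • eφ t) hκ0.ne' hr1 hr0
    (by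
      simp_rw [add_smul kt3]
      exact (((hψc.const_smul kt3).add ((continuous_rpow_norm_smul
        (by linarith)).comp_continuousOn hψc)).const_smul (-kt1)).add (hφc.const_smul m⁻¹))
    hdb (fun t ht => (hdv t ht).congr_deriv (by
      have hH : Hact (eb t) ((p - 1) / p) (ev t)
          = ev t + (r / ‖eb t‖ ^ 2 * ⟪eb t, ev t⟫) • eb t := by
        rw [Hact, ← hrc, neg_div, neg_mul, neg_smul, sub_eq_add_neg]
      rw [hφ1, hH]
      simp only [smul_add, smul_sub, smul_smul, neg_mul, mul_neg, ← mul_assoc,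
        inv_mul_cancel₀ hm.ne', one_mul, hψ]
      abel))
  have hηd : ∀ t, 0 ≤ t → HasDerivWithinAt (fun t => m⁻¹ • eφ t)
      (-(kt2 * ((kt3 + (1 - β) * ‖ψ t‖ ^ (-β)) * (kt3 + ‖ψ t‖ ^ (-β)))) • ψ t) (Ici t) t := by
    intro t ht
    refine ((hdφ t ht).const_smul m⁻¹).hasDerivWithinAt.congr_deriv ?_
    rw [hφ2, smul_smul, smul_smul]
    congr 1
    field_simp
    rfl
  have hsym : Pt 1 0 = Pt 0 1 := by simpa using hPt.isHermitian.apply 0 1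
  have hQ00 := congrFun (congrFun hLyapEq 0) 0
  have hQ01 := congrFun (congrFun hLyapEq 0) 1
  have hQ10 := congrFun (congrFun hLyapEq 1) 0
  have hQ11 := congrFun (congrFun hLyapEq 1) 1
  simp [Matrix.mul_apply, Fin.sum_univ_two, hsym] at hQ00 hQ01 hQ10 hQ11
  obtain ⟨T₁, hT₁, hz⟩ := superTwisting_finiteTime (k1 := kt1) (k2 := kt2) (P11 := Pt 0 0)
    (P12 := Pt 0 1) (P22 := Pt 1 1) h3 hβ0 hβ1 hpm hpM hqm
    (fun x y => (hPlow ![x, y]).trans_eq (by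
      simp [Matrix.mulVec, dotProduct, Fin.sum_univ_two, hsym]; ring))
    (fun x y => le_of_eq_of_le (by
      simp [Matrix.mulVec, dotProduct, Fin.sum_univ_two, hsym]; ring) (hPup ![x, y]))
    (fun x y => (hQlow ![x, y]).trans_eq (by
      simp [Matrix.mulVec, dotProduct, Fin.sum_univ_two]
      linear_combination x ^ 2 * hQ00 + x * y * hQ01 + x * y * hQ10 + y ^ 2 * hQ11))
    hψc (hφc.const_smul m⁻¹) hψd hηd
  have hev : ∀ t, T₁ ≤ t → ev t = -(κt • (eb t + ‖eb t‖ ^ r • eb t)) := fun t ht =>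
    eq_neg_of_add_eq_zero_left (hz t ht).1
  obtain ⟨T, hT, hb0⟩ := finiteTime_of_hasDerivAt_neg_rpow_norm hκ0 hr0 (u := eb) (T₀ := T₁)
    fun t ht => hev t ht ▸ hdb t (hT₁.trans ht)
  refine ⟨T, hT₁.trans hT, fun t ht => ⟨hb0 t ht, ?_, ?_⟩⟩
  · rw [hev t (hT.trans ht), hb0 t ht]; simp
  · exact (smul_eq_zero.1 (hz t (hT.trans ht)).2).resolve_left (inv_ne_zero hm.ne')
end
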